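/- Let V(r) = 1/(1−r²)² for r ∈ (0,1). Then the supremum of ∫_B e^{4π u(x)²} dx over all u ∈ C_c^∞(B) with ∫_B |∇u(x)|² dx − ∫_B u(x)²/(1−|x|²)² dx ≤ 1 is finite. -/

import Mathlib

open MeasureTheory Real Set Filter
open scoped ENNReal

noncomputable section

abbrev E2 := EuclideanSpace ℝ (Fin 2)

/-- The open unit disk in ℝ². -/
def unitDisk : Set E2 := Metric.ball 0 1

/-- `u ∈ C_c^∞(Ω)`: smooth with compact support contained in `Ω`. -/
def IsTestFun (Ω : Set E2) (u : E2 → ℝ) : Prop :=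
  ContDiff ℝ (⊤ : ℕ∞) u ∧ IsCompact (tsupport u) ∧ tsupport u ⊆ Ω

/-- The quadratic form `Q_V(u) = ∫_B |∇u|² - ∫_B V(|x|) u²`. -/
def QV (V : ℝ → ℝ) (u : E2 → ℝ) : ℝ :=
  (∫ x in unitDisk, ‖fderiv ℝ u x‖ ^ 2) - ∫ x in unitDisk, V ‖x‖ * u x ^ 2

/-- Weak coercivity of `Q_V`. -/
def WeaklyCoercive (V : ℝ → ℝ) : Prop :=
  ∃ E : Set E2, IsOpen E ∧ IsCompact (closure E) ∧ closure E ⊆ unitDisk ∧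
    ∃ δ : ℝ, 0 < δ ∧ ∀ u : E2 → ℝ, IsTestFun unitDisk u →
      δ * (∫ x in E, u x) ^ 2 ≤ QV V u

/-- The class 𝒱 of radial potentials. -/
def MemClassV (V : ℝ → ℝ) : Prop :=
  ContinuousOn V (Ioo 0 1) ∧ (∀ r ∈ Ioo (0:ℝ) 1, 0 ≤ V r) ∧
    AntitoneOn (fun r => (1 - r ^ 2) ^ 2 * V r) (Ioo 0 1)

/-- Condition (K): `r² (log(1/r))^{2+α} V(r) → 0` as `r → 0⁺`, for some `α > 0`. -/
def CondK (V : ℝ → ℝ) : Prop :=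
  ∃ α : ℝ, 0 < α ∧
    Tendsto (fun r : ℝ => r ^ 2 * Real.log (1 / r) ^ (2 + α) * V r)
      (nhdsWithin 0 (Ioi 0)) (nhds 0)

namespace HardyMoser

/-- Smooth functions whose support is a compact subset of the open unit disk of `ℂ`. -/
def IsDiskTest (u : ℂ → ℝ) : Prop :=
  ContDiff ℝ (⊤ : ℕ∞) u ∧ HasCompactSupport u ∧ tsupport u ⊆ Metric.ball 0 1

/-- The Hardy weight `(1 - |z|²)⁻²`. -/
def hardyWeight (z : ℂ) : ℝ := ((1 - ‖z‖ ^ 2) ^ 2)⁻¹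

/-- The bilinear form associated with `∫ |∇u|² - ∫ u² / (1 - |z|²)²`. -/
def hardyForm (u v : ℂ → ℝ) : ℝ :=
  ∫ z, (fderiv ℝ u z 1 * fderiv ℝ v z 1 + fderiv ℝ u z Complex.I * fderiv ℝ v z Complex.I
    - hardyWeight z * (u z * v z))

lemma one_sub_norm_sq_pos {z : ℂ} (hz : z ∈ Metric.ball (0 : ℂ) 1) : 0 < 1 - ‖z‖ ^ 2 := by
  have h : ‖z‖ < 1 := by simpa using hz
  nlinarith [norm_nonneg z]

lemma contDiffOn_hardyWeight : ContDiffOn ℝ (⊤ : ℕ∞) hardyWeight (Metric.ball 0 1) := by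
  refine ContDiffOn.inv ?_ fun z hz => (pow_pos (one_sub_norm_sq_pos hz) 2).ne'
  exact ((contDiff_const.sub (contDiff_norm_sq ℝ)).pow 2).contDiffOn

namespace IsDiskTest

variable {u v g : ℂ → ℝ}

lemma continuous (hu : IsDiskTest u) : Continuous u := hu.1.continuous

lemma integrable (hu : IsDiskTest u) : Integrable u :=
  hu.continuous.integrable_of_hasCompactSupport hu.2.1

lemma differentiable (hu : IsDiskTest u) : Differentiable ℝ u :=
  hu.1.differentiable (by simp)

lemma eq_zero (hu : IsDiskTest u) {z : ℂ} (hz : z ∉ Metric.ball (0 : ℂ) 1) : u z = 0 :=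
  image_eq_zero_of_notMem_tsupport fun h => hz (hu.2.2 h)

lemma mul_contDiffOn (hu : IsDiskTest u) (hg : ContDiffOn ℝ (⊤ : ℕ∞) g (Metric.ball 0 1)) :
    IsDiskTest (fun z => u z * g z) := by
  refine ⟨contDiff_iff_contDiffAt.2 fun z => ?_, hu.2.1.mul_right,
    (tsupport_mul_subset_left).trans hu.2.2⟩
  by_cases hz : z ∈ tsupport u
  · exact hu.1.contDiffAt.mul (hg.contDiffAt (Metric.isOpen_ball.mem_nhds (hu.2.2 hz)))
  · have h0 : (fun z => u z * g z) =ᶠ[nhds z] fun _ => 0 := by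
      filter_upwards [notMem_tsupport_iff_eventuallyEq.1 hz] with w hw
      simp [hw]
    exact contDiffAt_const.congr_of_eventuallyEq h0

lemma mul (hu : IsDiskTest u) (hv : IsDiskTest v) : IsDiskTest (fun z => u z * v z) :=
  hu.mul_contDiffOn hv.1.contDiffOn

lemma sub (hu : IsDiskTest u) (hv : IsDiskTest v) : IsDiskTest (fun z => u z - v z) :=
  ⟨hu.1.sub hv.1, hu.2.1.sub hv.2.1, (tsupport_sub u v).trans (union_subset hu.2.2 hv.2.2)⟩

lemma add (hu : IsDiskTest u) (hv : IsDiskTest v) : IsDiskTest (fun z => u z + v z) :=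
  ⟨hu.1.add hv.1, hu.2.1.add hv.2.1, (tsupport_add u v).trans (union_subset hu.2.2 hv.2.2)⟩

lemma const_mul (hu : IsDiskTest u) (c : ℝ) : IsDiskTest (fun z => c * u z) := by
  simpa [mul_comm] using hu.mul_contDiffOn (g := fun _ => c) contDiffOn_const

lemma neg (hu : IsDiskTest u) : IsDiskTest (fun z => - u z) := by
  simpa using hu.const_mul (-1)

lemma fderiv_apply (hu : IsDiskTest u) (w : ℂ) : IsDiskTest (fun z => fderiv ℝ u z w) := by
  have hsub : tsupport (fun z => fderiv ℝ u z w) ⊆ tsupport u := tsupport_fderiv_apply_subset ℝ w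
  refine ⟨?_, hu.2.1.mono' (subset_closure.trans hsub), hsub.trans hu.2.2⟩
  exact (hu.1.fderiv_right (m := (⊤ : ℕ∞)) (by simp)).clm_apply contDiff_const

lemma weight_mul (hu : IsDiskTest u) : IsDiskTest (fun z => hardyWeight z * u z) := by
  simpa [mul_comm] using hu.mul_contDiffOn contDiffOn_hardyWeight

lemma integral_fderiv_apply (hu : IsDiskTest u) (w : ℂ) : ∫ z, fderiv ℝ u z w = 0 := by
  have h := integral_mul_fderiv_eq_neg_fderiv_mul_of_integrable (μ := (volume : Measure ℂ))
    (f := fun _ : ℂ => (1 : ℝ)) (g := u) (v := w) (by simp)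
    (by simpa using (hu.fderiv_apply w).integrable) (by simpa using hu.integrable)
    (fun _ _ => differentiableAt_const _) (fun z _ => hu.differentiable z)
  simpa using h

lemma integral_fderiv_mul (hu : IsDiskTest u) (hv : IsDiskTest v) (w : ℂ) :
    ∫ z, fderiv ℝ u z w * fderiv ℝ v z w
      = - ∫ z, u z * fderiv ℝ (fun y => fderiv ℝ v y w) z w := by
  have h := integral_mul_fderiv_eq_neg_fderiv_mul_of_integrable (μ := (volume : Measure ℂ))
    (f := u) (g := fun y => fderiv ℝ v y w) (v := w)
    ((hu.fderiv_apply w).mul (hv.fderiv_apply w)).integrable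
    (hu.mul ((hv.fderiv_apply w).fderiv_apply w)).integrable
    (hu.mul (hv.fderiv_apply w)).integrable
    (fun z _ => hu.differentiable z) (fun z _ => (hv.fderiv_apply w).differentiable z)
  rw [h, neg_neg]

lemma hardyForm_integrand (hu : IsDiskTest u) (hv : IsDiskTest v) :
    IsDiskTest (fun z => fderiv ℝ u z 1 * fderiv ℝ v z 1
      + fderiv ℝ u z Complex.I * fderiv ℝ v z Complex.I - hardyWeight z * (u z * v z)) :=
  (((hu.fderiv_apply 1).mul (hv.fderiv_apply 1)).add
    ((hu.fderiv_apply _).mul (hv.fderiv_apply _))).sub (hu.mul hv).weight_mul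

lemma hardyForm_eq_integral (hu : IsDiskTest u) (hv : IsDiskTest v) :
    hardyForm u v = ∫ z, u z * (-(fderiv ℝ (fun y => fderiv ℝ v y 1) z 1
      + fderiv ℝ (fun y => fderiv ℝ v y Complex.I) z Complex.I) - hardyWeight z * v z) := by
  have i1 := (hu.fderiv_apply 1).mul (hv.fderiv_apply 1)
  have i2 := (hu.fderiv_apply Complex.I).mul (hv.fderiv_apply Complex.I)
  have i3 := (hu.mul hv).weight_mul
  have j1 := (hu.mul ((hv.fderiv_apply 1).fderiv_apply 1)).neg
  have j2 := (hu.mul ((hv.fderiv_apply Complex.I).fderiv_apply Complex.I)).neg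
  rw [hardyForm, integral_sub (i1.add i2).integrable i3.integrable,
    integral_add i1.integrable i2.integrable,
    hu.integral_fderiv_mul hv, hu.integral_fderiv_mul hv, ← integral_neg, ← integral_neg,
    ← integral_add j1.integrable j2.integrable,
    ← integral_sub (j1.add j2).integrable i3.integrable]
  congr 1
  ext z
  ring

lemma hardyForm_sub_smul (hu : IsDiskTest u) (hv : IsDiskTest v) (t : ℝ) :
    hardyForm (fun z => u z - t * v z) (fun z => u z - t * v z)
      = hardyForm u u - 2 * t * hardyForm u v + t ^ 2 * hardyForm v v := by
  have e : ∀ z w : ℂ, fderiv ℝ (fun z => u z - t * v z) z w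
      = fderiv ℝ u z w - t * fderiv ℝ v z w := fun z w => by
    rw [fderiv_fun_sub (hu.differentiable z) ((hv.differentiable z).const_mul t),
      fderiv_const_mul (hv.differentiable z)]
    simp
  unfold hardyForm
  rw [← integral_const_mul, ← integral_const_mul,
    ← integral_sub (hu.hardyForm_integrand hu).integrable
      ((hu.hardyForm_integrand hv).const_mul (2 * t)).integrable,
    ← integral_add ((hu.hardyForm_integrand hu).sub
      ((hu.hardyForm_integrand hv).const_mul (2 * t))).integrable
      ((hv.hardyForm_integrand hv).const_mul (t ^ 2)).integrable]
  congr 1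
  ext z
  simp only [e]
  ring

lemma hardyForm_add_right (hu : IsDiskTest u) (hv : IsDiskTest v) (hg : IsDiskTest g) :
    hardyForm u (fun z => v z + g z) = hardyForm u v + hardyForm u g := by
  unfold hardyForm
  rw [← integral_add (hu.hardyForm_integrand hv).integrable (hu.hardyForm_integrand hg).integrable]
  congr 1
  ext z
  rw [fderiv_fun_add (hv.differentiable z) (hg.differentiable z)]
  simp only [_root_.add_apply]
  ring

end IsDiskTest

lemma hardyForm_comm (u v : ℂ → ℝ) : hardyForm u v = hardyForm v u := by
  unfold hardyForm
  congr 1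
  ext z
  ring

lemma hasFDerivAt_field_div {z : ℂ} (hz : z ∈ Metric.ball (0 : ℂ) 1) (L : ℂ →L[ℝ] ℝ) :
    HasFDerivAt (fun y : ℂ => L y / (1 - (y.re ^ 2 + y.im ^ 2)))
      ((1 - (z.re ^ 2 + z.im ^ 2))⁻¹ • L + (L z * (2 / (1 - (z.re ^ 2 + z.im ^ 2)) ^ 2)) •
        (z.re • Complex.reCLM + z.im • Complex.imCLM)) z := by
  have hne : (1 - (z.re ^ 2 + z.im ^ 2)) ≠ 0 := by
    have := one_sub_norm_sq_pos hz
    rw [Complex.sq_norm, Complex.normSq_apply] at this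
    nlinarith
  have h1 : HasFDerivAt (fun y : ℂ => (1 : ℝ) - (y.re ^ 2 + y.im ^ 2))
      (-((2 * z.re) • Complex.reCLM + (2 * z.im) • Complex.imCLM)) z := by
    have a := (Complex.reCLM.hasFDerivAt (x := z)).pow 2
    have b := (Complex.imCLM.hasFDerivAt (x := z)).pow 2
    have c := (a.add b).const_sub (1 : ℝ)
    refine c.congr_fderiv ?_
    simp
  have h2 := (L.hasFDerivAt (x := z)).mul ((hasDerivAt_inv hne).comp_hasFDerivAt z h1)
  refine (h2.congr_fderiv ?_).congr_of_eventuallyEq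
    (Filter.Eventually.of_forall fun y => by simp [div_eq_mul_inv])
  ext
  simp
  field_simp
  ring

/-- The Hardy inequality on the disk, from the supersolution `(1 - |z|²)^{1/2}`. -/
lemma IsDiskTest.integral_sq_le_hardyForm {u : ℂ → ℝ} (hu : IsDiskTest u) :
    ∫ z, u z ^ 2 ≤ hardyForm u u := by
  set X : ℂ → ℝ := fun z => Complex.reCLM z / (1 - (z.re ^ 2 + z.im ^ 2))
  set Y : ℂ → ℝ := fun z => Complex.imCLM z / (1 - (z.re ^ 2 + z.im ^ 2))
  have hpos : ∀ z ∈ Metric.ball (0 : ℂ) 1, 0 < 1 - (z.re ^ 2 + z.im ^ 2) := fun z hz => by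
    have := one_sub_norm_sq_pos hz
    rw [Complex.sq_norm, Complex.normSq_apply] at this
    nlinarith
  have hden : ContDiff ℝ (⊤ : ℕ∞) fun z : ℂ => 1 - (z.re ^ 2 + z.im ^ 2) :=
    contDiff_const.sub ((Complex.reCLM.contDiff.pow 2).add (Complex.imCLM.contDiff.pow 2))
  have hXs : ContDiffOn ℝ (⊤ : ℕ∞) X (Metric.ball 0 1) :=
    Complex.reCLM.contDiff.contDiffOn.div hden.contDiffOn fun z hz => (hpos z hz).ne'
  have hYs : ContDiffOn ℝ (⊤ : ℕ∞) Y (Metric.ball 0 1) :=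
    Complex.imCLM.contDiff.contDiffOn.div hden.contDiffOn fun z hz => (hpos z hz).ne'
  have hF := (hu.mul hu).mul_contDiffOn hXs
  have hG := (hu.mul hu).mul_contDiffOn hYs
  have hI : ∫ z, (fderiv ℝ (fun y => u y * u y * X y) z 1
      + fderiv ℝ (fun y => u y * u y * Y y) z Complex.I) = 0 := by
    rw [integral_add (hF.fderiv_apply 1).integrable (hG.fderiv_apply _).integrable,
      hF.integral_fderiv_apply, hG.integral_fderiv_apply, add_zero]
  have hsq : IsDiskTest fun z => u z ^ 2 := by simpa [sq] using hu.mul hu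
  have key : ∫ z, (u z ^ 2 - (fderiv ℝ (fun y => u y * u y * X y) z 1
      + fderiv ℝ (fun y => u y * u y * Y y) z Complex.I)) ≤ hardyForm u u := by
    refine integral_mono (hsq.sub ((hF.fderiv_apply 1).add (hG.fderiv_apply _))).integrable
      (hu.hardyForm_integrand hu).integrable fun z => ?_
    by_cases hz : z ∈ Metric.ball (0 : ℂ) 1
    · have hd := hpos z hz
      have hu' := (hu.differentiable z).hasFDerivAt
      have e1 := ((hu'.mul hu').mul (hasFDerivAt_field_div hz Complex.reCLM)).fderiv
      have e2 := ((hu'.mul hu').mul (hasFDerivAt_field_div hz Complex.imCLM)).fderiv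
      have hw : hardyWeight z = ((1 - (z.re ^ 2 + z.im ^ 2)) ^ 2)⁻¹ := by
        rw [hardyWeight, Complex.sq_norm, Complex.normSq_apply, sq z.re, sq z.im]
      have f1 : fderiv ℝ (fun y => u y * u y * X y) z 1 = _ := DFunLike.congr_fun e1 1
      have f2 : fderiv ℝ (fun y => u y * u y * Y y) z Complex.I = _ :=
        DFunLike.congr_fun e2 Complex.I
      simp only [f1, f2, hw]
      simp
      set a := fderiv ℝ u z 1
      set b := fderiv ℝ u z Complex.I
      set d := 1 - (z.re ^ 2 + z.im ^ 2) with hdd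
      have hd1 : d ≤ 1 := by nlinarith [sq_nonneg z.re, sq_nonneg z.im]
      have h1 : 0 ≤ (a + u z * z.re / d) ^ 2 + (b + u z * z.im / d) ^ 2 + u z ^ 2 * (1 / d - 1) := by
        have : 1 ≤ 1 / d := by rw [le_div_iff₀ hd]; linarith
        have := mul_nonneg (sq_nonneg (u z)) (sub_nonneg.2 this)
        positivity
      have h2 : ∀ U x y : ℝ, a * a + b * b - (d ^ 2)⁻¹ * (U * U) +
          (U * U * d⁻¹ + U * U * (x * (2 / d ^ 2) * x) + (x / d * (U * a) + x / d * (U * a)) +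
          (U * U * d⁻¹ + U * U * (y * (2 / d ^ 2) * y) + (y / d * (U * b) + y / d * (U * b))))
          - U ^ 2 - ((a + U * x / d) ^ 2 + (b + U * y / d) ^ 2 + U ^ 2 * (1 / d - 1))
          = U ^ 2 / d ^ 2 * (x ^ 2 + y ^ 2 + d - 1) := fun U x y => by
        have hne := hd.ne'
        field_simp
        ring
      have h3 := h2 (u z) z.re z.im
      rw [show z.re ^ 2 + z.im ^ 2 + d - 1 = 0 by rw [hdd]; ring, mul_zero] at h3
      linarith
    · have hn : ∀ f : ℂ → ℝ, IsDiskTest f → f z = 0 := fun f hf => hf.eq_zero hz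
      have h1 := hn _ hsq
      have h2 := hn _ (hF.fderiv_apply 1)
      have h3 := hn _ (hG.fderiv_apply Complex.I)
      have h4 := hn _ (hu.hardyForm_integrand hu)
      simp only [h1, h2, h3, h4]
      simp
  rw [integral_sub hsq.integrable ((hF.fderiv_apply 1).add (hG.fderiv_apply _)).integrable, hI,
    sub_zero] at key
  exact key

/-- Dual estimate: a functional that `hardyForm` represents by `h` up to the `L²` error `P` is
bounded by an explicit quadratic expression in `h` and `P`. -/
lemma IsDiskTest.sq_dual_le {u h P : ℂ → ℝ} (hu : IsDiskTest u) (hh : IsDiskTest h)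
    (hP : Continuous P) (hPc : HasCompactSupport P) (h1 : hardyForm u u ≤ 1) :
    (hardyForm u h + ∫ z, u z * P z) ^ 2
      ≤ hardyForm h h + 2 * (∫ z, h z * P z) + ∫ z, P z ^ 2 := by
  have iP : Integrable fun z => P z ^ 2 := by
    have := (hP.mul hP).integrable_of_hasCompactSupport (μ := volume) hPc.mul_right
    exact this.congr (Filter.Eventually.of_forall fun z => by simp [sq])
  have iuP : Integrable fun z => u z * P z :=
    (hu.continuous.mul hP).integrable_of_hasCompactSupport hu.2.1.mul_right
  have ihP : Integrable fun z => h z * P z :=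
    (hh.continuous.mul hP).integrable_of_hasCompactSupport hh.2.1.mul_right
  set f := hardyForm u h + ∫ z, u z * P z with hf
  set N := hardyForm h h + 2 * (∫ z, h z * P z) + ∫ z, P z ^ 2 with hN
  have key : ∀ t : ℝ, 0 ≤ N * (t * t) + (-2 * f) * t + 1 := fun t => by
    have hw := hu.sub (hh.const_mul t)
    have a := hw.integral_sq_le_hardyForm
    rw [hu.hardyForm_sub_smul hh] at a
    have isq : Integrable fun z => (u z - t * h z) ^ 2 := by
      simpa [sq] using (hw.mul hw).integrable
    have b : ∫ z, (2 * t * (u z * P z) - 2 * t ^ 2 * (h z * P z) - t ^ 2 * P z ^ 2)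
        ≤ ∫ z, (u z - t * h z) ^ 2 := by
      refine integral_mono (((iuP.const_mul _).sub (ihP.const_mul _)).sub (iP.const_mul _)) isq
        fun z => ?_
      have := sq_nonneg (u z - t * h z - t * P z)
      simp only
      nlinarith
    have i1 : Integrable fun z => 2 * t * (u z * P z) - 2 * t ^ 2 * (h z * P z) :=
      (iuP.const_mul _).sub (ihP.const_mul _)
    rw [integral_sub i1 (iP.const_mul _),
      integral_sub (iuP.const_mul _) (ihP.const_mul _), integral_const_mul, integral_const_mul,
      integral_const_mul] at b
    rw [hf, hN]
    nlinarith
  have := discrim_le_zero key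
  rw [discrim] at this
  nlinarith

/-- A smooth cutoff of `|z|²`, equal to `1` on `[0, 1/16]` and supported in `[0, 1/4]`. -/
def cutoff : ContDiffBump (0 : ℝ) := ⟨1 / 16, 1 / 4, by norm_num, by norm_num⟩

/-- The regularised logarithmic potential as a function of `|z|²`. -/
def logPot (ε s : ℝ) : ℝ := -(4 * π)⁻¹ * log (s + ε ^ 2)

/-- The truncated regularised logarithmic kernel. -/
def kernel (ε : ℝ) (z : ℂ) : ℝ := cutoff (‖z‖ ^ 2) * logPot ε (‖z‖ ^ 2)

/-- The singular part of `-Δ kernel`, an approximate identity. -/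
def kernelMass (ε : ℝ) (z : ℂ) : ℝ :=
  cutoff (‖z‖ ^ 2) * (ε ^ 2 / (π * (‖z‖ ^ 2 + ε ^ 2) ^ 2))

/-- The radial profile of `kernelRest`. -/
def restProfile (ε s : ℝ) : ℝ :=
  4 * (deriv cutoff s * logPot ε s + s * (deriv (deriv cutoff) s * logPot ε s
    + 2 * (deriv cutoff s * (-(4 * π)⁻¹ * (s + ε ^ 2)⁻¹))))

/-- The regular part of `Δ kernel`. -/
def kernelRest (ε : ℝ) (z : ℂ) : ℝ := restProfile ε (‖z‖ ^ 2)

lemma cutoff_contDiff : ContDiff ℝ (⊤ : ℕ∞) cutoff := cutoff.contDiff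

lemma cutoff_deriv_contDiff : ContDiff ℝ (⊤ : ℕ∞) (deriv cutoff) := by
  have h := cutoff.contDiff (n := (⊤ : ℕ∞))
  exact ((contDiff_succ_iff_deriv (n := (⊤ : ℕ∞))).1 (by simpa using h)).2.2

lemma cutoff_deriv_deriv_continuous : Continuous (deriv (deriv cutoff)) :=
  cutoff_deriv_contDiff.continuous_deriv (by simp)

lemma cutoff_nonneg (s : ℝ) : 0 ≤ cutoff s := cutoff.nonneg

lemma cutoff_le_one (s : ℝ) : cutoff s ≤ 1 := cutoff.le_one

lemma cutoff_eq_zero {s : ℝ} (hs : 1 / 4 ≤ s) : cutoff s = 0 :=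
  cutoff.zero_of_le_dist (by simpa [cutoff] using hs.trans (le_abs_self s))

lemma logPot_hasDerivAt {ε s : ℝ} (h : 0 < s + ε ^ 2) :
    HasDerivAt (logPot ε) (-(4 * π)⁻¹ * (s + ε ^ 2)⁻¹) s := by
  have := (((hasDerivAt_id s).add_const (ε ^ 2)).log h.ne').const_mul (-(4 * π)⁻¹)
  rw [one_div] at this
  exact this

lemma logPot_nonneg {ε s : ℝ} (h0 : 0 < s + ε ^ 2) (h1 : s + ε ^ 2 ≤ 1) : 0 ≤ logPot ε s := by
  have := log_nonpos h0.le h1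
  have h : 0 < (4 * π)⁻¹ := by positivity
  unfold logPot
  nlinarith

lemma hasFDerivAt_comp_norm_sq {g : ℝ → ℝ} {g' : ℝ} {z : ℂ} (h : HasDerivAt g g' (‖z‖ ^ 2)) :
    HasFDerivAt (fun y : ℂ => g (‖y‖ ^ 2)) ((2 * g') • innerSL ℝ z) z := by
  have := h.comp_hasFDerivAt z (hasStrictFDerivAt_norm_sq z).hasFDerivAt
  refine this.congr_fderiv ?_
  ext
  simp
  ring

/-- The Laplacian of a radial function written in terms of `|z|²`. -/
lemma laplacian_comp_norm_sq {g g₁ g₂ : ℝ → ℝ} (h₁ : ∀ s, 0 ≤ s → HasDerivAt g (g₁ s) s)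
    (h₂ : ∀ s, 0 ≤ s → HasDerivAt g₁ (g₂ s) s) (z : ℂ) :
    fderiv ℝ (fun y : ℂ => fderiv ℝ (fun x : ℂ => g (‖x‖ ^ 2)) y 1) z 1
      + fderiv ℝ (fun y : ℂ => fderiv ℝ (fun x : ℂ => g (‖x‖ ^ 2)) y Complex.I) z Complex.I
      = 4 * (g₁ (‖z‖ ^ 2) + ‖z‖ ^ 2 * g₂ (‖z‖ ^ 2)) := by
  have e : ∀ w : ℂ, (fun y : ℂ => fderiv ℝ (fun x : ℂ => g (‖x‖ ^ 2)) y w)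
      = fun y => 2 * g₁ (‖y‖ ^ 2) * innerSL ℝ w y := fun w => by
    ext y
    rw [(hasFDerivAt_comp_norm_sq (h₁ _ (sq_nonneg _))).fderiv]
    simp [real_inner_comm]
  have d : ∀ w : ℂ, fderiv ℝ (fun y : ℂ => 2 * g₁ (‖y‖ ^ 2) * innerSL ℝ w y) z w
      = 2 * g₁ (‖z‖ ^ 2) * ‖w‖ ^ 2 + 4 * g₂ (‖z‖ ^ 2) * (inner ℝ w z) ^ 2 := fun w => by
    have := ((hasFDerivAt_comp_norm_sq (h₂ _ (sq_nonneg ‖z‖))).const_mul 2).mul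
      ((innerSL ℝ w).hasFDerivAt (x := z))
    refine (DFunLike.congr_fun this.fderiv w).trans ?_
    simp [real_inner_comm]
    ring
  rw [e, e, d, d, Complex.sq_norm, Complex.normSq_apply]
  simp [Complex.inner]
  ring

lemma kernel_laplacian {ε : ℝ} (hε : 0 < ε) (z : ℂ) :
    fderiv ℝ (fun y : ℂ => fderiv ℝ (kernel ε) y 1) z 1
      + fderiv ℝ (fun y : ℂ => fderiv ℝ (kernel ε) y Complex.I) z Complex.I
      = kernelRest ε z - kernelMass ε z := by
  have hd : ∀ s, HasDerivAt cutoff (deriv cutoff s) s := fun s =>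
    (cutoff_contDiff.differentiable (by simp) s).hasDerivAt
  have hd' : ∀ s, HasDerivAt (deriv cutoff) (deriv (deriv cutoff) s) s := fun s =>
    (cutoff_deriv_contDiff.differentiable (by simp) s).hasDerivAt
  have hp : ∀ s : ℝ, 0 ≤ s → 0 < s + ε ^ 2 := fun s hs => by positivity
  have hi : ∀ s : ℝ, 0 ≤ s → HasDerivAt (fun s => -(4 * π)⁻¹ * (s + ε ^ 2)⁻¹)
      (-(4 * π)⁻¹ * -((s + ε ^ 2) ^ 2)⁻¹) s := fun s hs => by
    have := (((hasDerivAt_id s).add_const (ε ^ 2)).inv (hp s hs).ne').const_mul (-(4 * π)⁻¹)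
    simpa [neg_div] using this
  have := laplacian_comp_norm_sq (g := fun s => cutoff s * logPot ε s)
    (fun s hs => (hd s).mul (logPot_hasDerivAt (hp s hs)))
    (fun s hs => ((hd' s).mul (logPot_hasDerivAt (hp s hs))).add ((hd s).mul (hi s hs))) z
  refine this.trans ?_
  have h := (hp _ (sq_nonneg ‖z‖)).ne'
  unfold kernelRest kernelMass restProfile
  field_simp
  ring

lemma kernel_contDiff {ε : ℝ} (hε : 0 < ε) : ContDiff ℝ (⊤ : ℕ∞) (kernel ε) := by
  refine (cutoff_contDiff.comp (contDiff_norm_sq ℝ)).mul (contDiff_const.mul ?_)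
  exact ((contDiff_norm_sq ℝ).add contDiff_const).log fun z => by positivity

lemma one_fourth_le_norm_sq {z : ℂ} (hz : z ∉ Metric.closedBall (0 : ℂ) (1 / 2)) :
    1 / 4 < ‖z‖ ^ 2 := by
  have : 1 / 2 < ‖z‖ := by simpa using hz
  nlinarith

lemma kernel_tsupport (ε : ℝ) : tsupport (kernel ε) ⊆ Metric.closedBall 0 (1 / 2) :=
  closure_minimal (fun z hz => by
    by_contra h
    exact hz (by simp [kernel, cutoff_eq_zero (one_fourth_le_norm_sq h).le]))
    Metric.isClosed_closedBall

lemma kernel_eq_zero {ε : ℝ} {z : ℂ} (hz : z ∉ Metric.closedBall (0 : ℂ) (1 / 2)) :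
    kernel ε z = 0 :=
  image_eq_zero_of_notMem_tsupport fun h => hz (kernel_tsupport ε h)

lemma kernel_le_of_pos {ε : ℝ} (hε : 0 < ε) (hε' : ε ≤ 1 / 2) {z : ℂ} {c : ℝ} (hc : 0 ≤ c)
    (h : ‖z‖ ^ 2 < 1 / 4 → logPot ε (‖z‖ ^ 2) ≤ c) : kernel ε z ≤ c := by
  rcases le_or_gt (1 / 4) (‖z‖ ^ 2) with h1 | h1
  · simpa [kernel, cutoff_eq_zero h1] using hc
  · have := logPot_nonneg (ε := ε) (s := ‖z‖ ^ 2) (by positivity) (by nlinarith)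
    exact (mul_le_of_le_one_left this (cutoff_le_one _)).trans (h h1)

lemma kernel_nonneg {ε : ℝ} (hε : 0 < ε) (hε' : ε ≤ 1 / 2) (z : ℂ) : 0 ≤ kernel ε z := by
  rcases le_or_gt (1 / 4) (‖z‖ ^ 2) with h1 | h1
  · simp [kernel, cutoff_eq_zero h1]
  · exact mul_nonneg (cutoff_nonneg _)
      (logPot_nonneg (by positivity) (by nlinarith))

lemma logPot_le {ε : ℝ} {z : ℂ} (hz : z ≠ 0) :
    logPot ε (‖z‖ ^ 2) ≤ (2 * π)⁻¹ * -log ‖z‖ := by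
  have hz' : 0 < ‖z‖ := norm_pos_iff.2 hz
  have h1 : log (‖z‖ ^ 2) ≤ log (‖z‖ ^ 2 + ε ^ 2) :=
    log_le_log (by positivity) (by nlinarith [sq_nonneg ε])
  rw [log_pow] at h1
  push_cast at h1
  have h : 0 < (4 * π)⁻¹ := by positivity
  have e : (2 * π)⁻¹ = 2 * (4 * π)⁻¹ := by field_simp; norm_num
  rw [logPot, e]
  nlinarith

lemma kernel_le_log_add {ε r : ℝ} (hε : 0 < ε) (hε' : ε ≤ 1 / 2) (hr : 0 < r) (hr1 : r ≤ 1)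
    {z : ℂ} (hz : z ≠ 0) : kernel ε z ≤ (2 * π)⁻¹ * (-log r + r * ‖z‖⁻¹) := by
  have hz' : 0 < ‖z‖ := norm_pos_iff.2 hz
  have hl := log_nonpos hr.le hr1
  have hq : 0 < r * ‖z‖⁻¹ := by positivity
  have h2 : 0 < (2 * π)⁻¹ := by positivity
  refine kernel_le_of_pos hε hε' (mul_nonneg h2.le (by linarith)) fun _ =>
    (logPot_le hz).trans (mul_le_mul_of_nonneg_left ?_ h2.le)
  have := log_le_sub_one_of_pos hq
  rw [log_mul hr.ne' (by positivity), log_inv] at this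
  linarith

lemma kernel_sq_le {ε : ℝ} (hε : 0 < ε) (hε' : ε ≤ 1 / 2) {z : ℂ} (hz : z ≠ 0) :
    kernel ε z ^ 2 ≤ ‖z‖⁻¹ := by
  have hz' : 0 < ‖z‖⁻¹ := inv_pos.2 (norm_pos_iff.2 hz)
  have : kernel ε z ≤ √(‖z‖⁻¹) := by
    refine kernel_le_of_pos hε hε' (sqrt_nonneg _) fun _ => (logPot_le hz).trans ?_
    have h1 := log_le_sub_one_of_pos (sqrt_pos.2 hz')
    rw [log_sqrt hz'.le, log_inv] at h1
    have h2 : (2 * π)⁻¹ ≤ 1 / 6 := by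
      rw [inv_le_comm₀ (by positivity) (by norm_num)]
      linarith [pi_gt_three]
    have h3 : 0 < (2 * π)⁻¹ := by positivity
    have h4 := sqrt_nonneg (‖z‖⁻¹)
    nlinarith
  calc kernel ε z ^ 2 ≤ √(‖z‖⁻¹) ^ 2 := pow_le_pow_left₀ (kernel_nonneg hε hε' z) this 2
    _ = ‖z‖⁻¹ := sq_sqrt hz'.le

lemma cutoff_deriv_eq_zero {s : ℝ} (h : |s| < 1 / 16 ∨ 1 / 4 < s) :
    deriv cutoff s = 0 ∧ deriv (deriv cutoff) s = 0 := by
  have hc : ∀ {t : ℝ} {c : ℝ}, cutoff =ᶠ[nhds t] (fun _ => c) → deriv cutoff t = 0 :=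
    fun h => by rw [h.deriv_eq, deriv_const]
  obtain ⟨c, hev⟩ : ∃ c : ℝ, ∀ᶠ t in nhds s, cutoff =ᶠ[nhds t] (fun _ => c) := by
    rcases h with h | h
    · refine ⟨1, ?_⟩
      have : Metric.ball (0 : ℝ) (1 / 16) ∈ nhds s :=
        Metric.isOpen_ball.mem_nhds (by simpa using h)
      filter_upwards [eventually_mem_nhds_iff.2 this] with t ht
      filter_upwards [ht] with y hy
      exact cutoff.one_of_mem_closedBall (Metric.ball_subset_closedBall hy)
    · refine ⟨0, ?_⟩
      have : Ioi (1 / 4 : ℝ) ∈ nhds s := Ioi_mem_nhds h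
      filter_upwards [eventually_mem_nhds_iff.2 this] with t ht
      filter_upwards [ht] with y hy
      exact cutoff_eq_zero (le_of_lt hy)
  have h0 : deriv cutoff =ᶠ[nhds s] fun _ => 0 := hev.mono fun t ht => hc ht
  exact ⟨h0.self_of_nhds, by rw [h0.deriv_eq, deriv_const]⟩

lemma kernelRest_eq_zero {ε : ℝ} {z : ℂ} (hz : z ∉ Metric.closedBall (0 : ℂ) (1 / 2)) :
    kernelRest ε z = 0 := by
  obtain ⟨h1, h2⟩ := cutoff_deriv_eq_zero (Or.inr (one_fourth_le_norm_sq hz))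
  simp [kernelRest, restProfile, h1, h2]

lemma kernelRest_continuous {ε : ℝ} (hε : 0 < ε) : Continuous (kernelRest ε) := by
  have hp : ∀ z : ℂ, ‖z‖ ^ 2 + ε ^ 2 ≠ 0 := fun z => by positivity
  have hs : Continuous fun z : ℂ => ‖z‖ ^ 2 := by fun_prop
  have h1 := cutoff_deriv_contDiff.continuous.comp hs
  have h2 := cutoff_deriv_deriv_continuous.comp hs
  have h3 : Continuous fun z : ℂ => logPot ε (‖z‖ ^ 2) :=
    continuous_const.mul ((hs.add continuous_const).log hp)
  have h4 : Continuous fun z : ℂ => (‖z‖ ^ 2 + ε ^ 2)⁻¹ := (hs.add continuous_const).inv₀ hp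
  exact continuous_const.mul ((h1.mul h3).add (hs.mul ((h2.mul h3).add
    (continuous_const.mul (h1.mul (continuous_const.mul h4))))))

lemma exists_abs_kernelRest_le : ∃ M : ℝ, 0 ≤ M ∧ ∀ ε : ℝ, 0 < ε → ε ≤ 1 / 2 → ∀ z,
    |kernelRest ε z| ≤ M := by
  obtain ⟨A, hA⟩ := (isCompact_Icc (a := (0 : ℝ)) (b := 1 / 4)).exists_bound_of_continuousOn
    cutoff_deriv_contDiff.continuous.continuousOn
  obtain ⟨B, hB⟩ := (isCompact_Icc (a := (0 : ℝ)) (b := 1 / 4)).exists_bound_of_continuousOn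
    cutoff_deriv_deriv_continuous.continuousOn
  have hA0 : 0 ≤ A := (norm_nonneg _).trans (hA 0 (by norm_num))
  have hB0 : 0 ≤ B := (norm_nonneg _).trans (hB 0 (by norm_num))
  set L := 16 + (4 * π)⁻¹ * 16 with hL
  have hLL : 0 ≤ L := by positivity
  refine ⟨4 * (A * L + 1 * (B * L + 2 * (A * L))), by positivity, fun ε hε hε' z => ?_⟩
  rcases lt_or_ge (‖z‖ ^ 2) (1 / 16) with h | h
  · obtain ⟨h1, h2⟩ := cutoff_deriv_eq_zero (s := ‖z‖ ^ 2)
      (Or.inl (by rwa [abs_of_nonneg (sq_nonneg _)]))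
    simp only [kernelRest, restProfile, h1, h2]
    simp
    positivity
  rcases lt_or_ge (1 / 4) (‖z‖ ^ 2) with h' | h'
  · obtain ⟨h1, h2⟩ := cutoff_deriv_eq_zero (s := ‖z‖ ^ 2) (Or.inr h')
    simp only [kernelRest, restProfile, h1, h2]
    simp
    positivity
  set s := ‖z‖ ^ 2 with hs
  have hA' := hA s ⟨by linarith, h'⟩
  have hB' := hB s ⟨by linarith, h'⟩
  rw [Real.norm_eq_abs] at hA' hB'
  have hpos : 0 < s + ε ^ 2 := by positivity
  have hi : (s + ε ^ 2)⁻¹ ≤ 16 := by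
    rw [inv_le_comm₀ hpos (by norm_num)]
    nlinarith
  have hl0 := logPot_nonneg hpos (by nlinarith)
  have hl : |logPot ε s| ≤ L := by
    rw [abs_of_nonneg hl0, logPot]
    have := log_le_sub_one_of_pos (inv_pos.2 hpos)
    rw [log_inv] at this
    have h4 : 0 < (4 * π)⁻¹ := by positivity
    nlinarith
  have hd : |-(4 * π)⁻¹ * (s + ε ^ 2)⁻¹| ≤ L := by
    rw [abs_mul, abs_neg, abs_of_pos (by positivity), abs_of_pos (inv_pos.2 hpos)]
    have h4 : 0 < (4 * π)⁻¹ := by positivity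
    nlinarith
  have hs1 : |s| ≤ 1 := by rw [abs_of_nonneg (by linarith)]; linarith
  unfold kernelRest restProfile
  rw [← hs, abs_mul, abs_of_nonneg (by norm_num : (0 : ℝ) ≤ 4)]
  refine mul_le_mul_of_nonneg_left ((abs_add_le _ _).trans (add_le_add ?_ ?_)) (by norm_num)
  · rw [abs_mul]
    gcongr
  · rw [abs_mul]
    refine mul_le_mul hs1 ((abs_add_le _ _).trans (add_le_add ?_ ?_)) (abs_nonneg _) zero_le_one
    · rw [abs_mul]
      gcongr
    · rw [abs_mul, abs_mul (deriv _ _), abs_two]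
      gcongr

lemma kernelMass_nonneg (ε : ℝ) (z : ℂ) : 0 ≤ kernelMass ε z :=
  mul_nonneg (cutoff_nonneg _) (by positivity)

lemma kernelMass_continuous {ε : ℝ} (hε : 0 < ε) : Continuous (kernelMass ε) := by
  have hp : ∀ z : ℂ, π * (‖z‖ ^ 2 + ε ^ 2) ^ 2 ≠ 0 := fun z => by positivity
  have hs : Continuous fun z : ℂ => ‖z‖ ^ 2 := by fun_prop
  exact (cutoff_contDiff.continuous.comp hs).mul
    (continuous_const.div (by fun_prop) hp)

lemma kernelMass_eq_zero {ε : ℝ} {z : ℂ} (hz : z ∉ Metric.closedBall (0 : ℂ) (1 / 2)) :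
    kernelMass ε z = 0 := by
  simp [kernelMass, cutoff_eq_zero (one_fourth_le_norm_sq hz).le]

/-- A rational approximate-identity profile on the plane. -/
def bubble (z : ℂ) : ℝ := (π * (1 + ‖z‖ ^ 2) ^ 2)⁻¹

lemma bubble_pos (z : ℂ) : 0 < bubble z := by unfold bubble; positivity

lemma integral_bubble : ∫ z, bubble z = 1 := by
  have h := integral_fun_norm_addHaar (volume : Measure ℂ) fun r : ℝ => (π * (1 + r ^ 2) ^ 2)⁻¹
  refine h.trans ?_
  have hd : ∀ r ∈ Ici (0 : ℝ), HasDerivAt (fun r => -(2 * π)⁻¹ * (1 + r ^ 2)⁻¹)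
      (r ^ (Module.finrank ℝ ℂ - 1) • (π * (1 + r ^ 2) ^ 2)⁻¹) r := fun r _ => by
    have hp : 1 + r ^ 2 ≠ 0 := by positivity
    have := ((((hasDerivAt_id r).pow 2).const_add 1).inv hp).const_mul (-(2 * π)⁻¹)
    refine this.congr_deriv ?_
    simp
    field_simp
  have hl : Tendsto (fun r : ℝ => -(2 * π)⁻¹ * (1 + r ^ 2)⁻¹) atTop (nhds 0) := by
    have : Tendsto (fun r : ℝ => 1 + r ^ 2) atTop atTop :=
      tendsto_atTop_add_const_left _ _ (tendsto_pow_atTop two_ne_zero)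
    simpa using (tendsto_inv_atTop_zero.comp this).const_mul (-(2 * π)⁻¹)
  rw [integral_Ioi_of_hasDerivAt_of_nonneg' hd (fun r hr => by
    have : (0 : ℝ) < r := hr
    simp
    positivity) hl]
  have hv : (volume : Measure ℂ).real (Metric.ball 0 1) = π := by
    simp [Measure.real, Complex.volume_ball]
  rw [hv]
  simp

lemma tendsto_norm_sq_mul_bubble :
    Tendsto (fun z : ℂ => ‖z‖ ^ Module.finrank ℝ ℂ * bubble z) (Bornology.cobounded ℂ) (nhds 0) := by
  have h1 : Tendsto (fun z : ℂ => π⁻¹ * (1 + ‖z‖ ^ 2)⁻¹) (Bornology.cobounded ℂ) (nhds 0) := by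
    have : Tendsto (fun z : ℂ => 1 + ‖z‖ ^ 2) (Bornology.cobounded ℂ) atTop :=
      tendsto_atTop_add_const_left _ _
        ((tendsto_pow_atTop two_ne_zero).comp tendsto_norm_cobounded_atTop)
    simpa using (tendsto_inv_atTop_zero.comp this).const_mul π⁻¹
  refine squeeze_zero (fun z => mul_nonneg (by positivity) (bubble_pos z).le) (fun z => ?_) h1
  have : ‖z‖ ^ 2 * (1 + ‖z‖ ^ 2)⁻¹ ≤ 1 := by
    rw [mul_inv_le_iff₀ (by positivity)]
    linarith
  have h0 : 0 ≤ π⁻¹ * (1 + ‖z‖ ^ 2)⁻¹ := by positivity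
  calc ‖z‖ ^ Module.finrank ℝ ℂ * bubble z
      = (‖z‖ ^ 2 * (1 + ‖z‖ ^ 2)⁻¹) * (π⁻¹ * (1 + ‖z‖ ^ 2)⁻¹) := by
        rw [Complex.finrank_real_complex, bubble]
        field_simp
    _ ≤ _ := mul_le_of_le_one_left h0 this

lemma kernelMass_eq {ε : ℝ} (hε : 0 < ε) (z : ℂ) :
    kernelMass ε z = cutoff (‖z‖ ^ 2) * (ε⁻¹ ^ Module.finrank ℝ ℂ * bubble (ε⁻¹ • z)) := by
  rw [kernelMass, bubble, norm_smul, Complex.finrank_real_complex, norm_inv,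
    Real.norm_of_nonneg hε.le]
  congr 1
  field_simp
  ring

lemma kernelMass_integrable {ε : ℝ} (hε : 0 < ε) : Integrable (kernelMass ε) :=
  (kernelMass_continuous hε).integrable_of_hasCompactSupport
    (HasCompactSupport.intro (isCompact_closedBall 0 (1 / 2)) fun _ => kernelMass_eq_zero)

lemma integral_kernelMass_le {ε : ℝ} (hε : 0 < ε) : ∫ z, kernelMass ε z ≤ 1 := by
  have hb : Integrable bubble := by
    by_contra h
    have := integral_bubble
    rw [integral_undef h] at this
    norm_num at this
  have hi : Integrable fun z : ℂ => ε⁻¹ ^ Module.finrank ℝ ℂ * bubble (ε⁻¹ • z) :=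
    (hb.comp_smul (inv_pos.2 hε).ne').const_mul _
  calc ∫ z, kernelMass ε z ≤ ∫ z : ℂ, ε⁻¹ ^ Module.finrank ℝ ℂ * bubble (ε⁻¹ • z) :=
        integral_mono (kernelMass_integrable hε) hi fun z => by
          rw [kernelMass_eq hε]
          exact mul_le_of_le_one_left (mul_nonneg (by positivity) (bubble_pos _).le)
            (cutoff_le_one _)
    _ = 1 := by
        rw [integral_const_mul, Measure.integral_comp_smul, integral_bubble,
          abs_of_pos (by positivity)]
        simp
        field_simp

/-- `kernelMass` is an approximate identity. -/
lemma tendsto_integral_mul_kernelMass {u : ℂ → ℝ} (hu : Continuous u) (y : ℂ) :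
    Tendsto (fun ε => ∫ x, u x * kernelMass ε (x - y)) (nhdsWithin 0 (Ioi 0)) (nhds (u y)) := by
  have hc : Continuous fun x : ℂ => cutoff (‖y - x‖ ^ 2) * u x :=
    (cutoff_contDiff.continuous.comp (by fun_prop)).mul hu
  have hs : HasCompactSupport fun x : ℂ => cutoff (‖y - x‖ ^ 2) * u x :=
    HasCompactSupport.intro (isCompact_closedBall y (1 / 2)) fun x hx => by
      have : y - x ∉ Metric.closedBall (0 : ℂ) (1 / 2) := by
        simpa [dist_eq_norm, norm_sub_rev] using hx
      simp [cutoff_eq_zero (one_fourth_le_norm_sq this).le]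
  have h := tendsto_integral_comp_smul_smul_of_integrable' (μ := (volume : Measure ℂ))
    (fun z => (bubble_pos z).le) integral_bubble tendsto_norm_sq_mul_bubble
    (hc.integrable_of_hasCompactSupport hs) (hc.continuousAt (x := y))
  have h2 := h.comp tendsto_inv_nhdsGT_zero
  have h1 : cutoff (0 : ℝ) = 1 :=
    cutoff.one_of_mem_closedBall (Metric.mem_closedBall_self cutoff.rIn_pos.le)
  simp only [sub_self, norm_zero, ne_eq, OfNat.ofNat_ne_zero, not_false_eq_true, zero_pow, h1,
    one_mul] at h2
  refine h2.congr' ?_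
  filter_upwards [self_mem_nhdsWithin] with ε hε
  refine integral_congr_ae (Filter.Eventually.of_forall fun x => ?_)
  simp only [kernelMass_eq hε, norm_sub_rev x y, smul_eq_mul]
  have : bubble (ε⁻¹ • (x - y)) = bubble (ε⁻¹ • (y - x)) := by
    rw [bubble, bubble, norm_smul, norm_smul, norm_sub_rev]
  rw [this]
  ring

lemma integrableOn_norm_inv (r : ℝ) : IntegrableOn (fun z : ℂ => ‖z‖⁻¹) (Metric.ball 0 r) := by
  refine (integrableOn_fun_norm_addHaar (volume : Measure ℂ) (f := fun r : ℝ => r⁻¹)).2 ?_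
  have : IntegrableOn (fun _ : ℝ => (1 : ℝ)) (Ioo 0 r) := integrableOn_const (by simp)
  refine this.congr_fun (fun x hx => ?_) measurableSet_Ioo
  have : x ≠ 0 := hx.1.ne'
  simp [this]

lemma integral_norm_inv {r : ℝ} (hr : 0 ≤ r) : ∫ z in Metric.ball (0 : ℂ) r, ‖z‖⁻¹ = 2 * π * r := by
  have h := integral_fun_norm_addHaar (volume : Measure ℂ) ((Iio r).indicator fun r : ℝ => r⁻¹)
  have e : (fun z : ℂ => (Iio r).indicator (fun r : ℝ => r⁻¹) ‖z‖)
      = (Metric.ball (0 : ℂ) r).indicator fun z => ‖z‖⁻¹ := by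
    ext z
    simp [indicator]
  rw [e, integral_indicator measurableSet_ball] at h
  rw [h]
  have hv : (volume : Measure ℂ).real (Metric.ball 0 1) = π := by
    simp [Measure.real, Complex.volume_ball]
  have h2 : ∫ y in Ioi (0 : ℝ), y ^ (Module.finrank ℝ ℂ - 1) • (Iio r).indicator (fun r : ℝ => r⁻¹) y
      = ∫ y in Ioi (0 : ℝ), (Iio r).indicator (fun _ => (1 : ℝ)) y := by
    refine setIntegral_congr_fun measurableSet_Ioi fun y hy => ?_
    have : y ≠ 0 := ne_of_gt hy
    simp [indicator, this]
  rw [hv, h2, integral_indicator measurableSet_Iio, Measure.restrict_restrict measurableSet_Iio,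
    Iio_inter_Ioi]
  simp [hr]
  ring

/-- The average of the translates of `g` with respect to `ν`. -/
def smear (ν : Measure ℂ) (g : ℂ → ℝ) (x : ℂ) : ℝ := ∫ y, g (x - y) ∂ν

section smear

variable {ν : Measure ℂ} {g f : ℂ → ℝ}

lemma smear_eq_convolution (ν : Measure ℂ) (g : ℂ → ℝ) :
    smear ν g = convolution (fun _ => (1 : ℝ)) g (ContinuousLinearMap.lsmul ℝ ℝ) ν := by
  ext x
  simp [smear, convolution]

lemma smear_nonneg (hg : ∀ z, 0 ≤ g z) (x : ℂ) : 0 ≤ smear ν g x :=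
  integral_nonneg fun y => hg (x - y)

lemma smear_eq_zero (hν : ∀ᵐ y ∂ν, y ∈ Metric.ball (0 : ℂ) (1 / 4))
    (hg : ∀ z, z ∉ Metric.closedBall (0 : ℂ) (1 / 2) → g z = 0) {x : ℂ}
    (hx : x ∉ Metric.closedBall (0 : ℂ) (3 / 4)) : smear ν g x = 0 := by
  refine integral_eq_zero_of_ae ?_
  filter_upwards [hν] with y hy
  refine hg _ fun h => hx ?_
  simp only [Metric.mem_closedBall, Metric.mem_ball, dist_zero_right] at *
  calc ‖x‖ = ‖(x - y) + y‖ := by rw [sub_add_cancel]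
    _ ≤ ‖x - y‖ + ‖y‖ := norm_add_le _ _
    _ ≤ 3 / 4 := by linarith

lemma hasCompactSupport_of_half (hg : ∀ z, z ∉ Metric.closedBall (0 : ℂ) (1 / 2) → g z = 0) :
    HasCompactSupport g :=
  HasCompactSupport.intro (isCompact_closedBall 0 (1 / 2)) fun x hx => hg x hx

lemma smear_hasCompactSupport (hν : ∀ᵐ y ∂ν, y ∈ Metric.ball (0 : ℂ) (1 / 4))
    (hg : ∀ z, z ∉ Metric.closedBall (0 : ℂ) (1 / 2) → g z = 0) :
    HasCompactSupport (smear ν g) :=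
  HasCompactSupport.intro (isCompact_closedBall 0 (3 / 4)) fun _ => smear_eq_zero hν hg

variable [IsProbabilityMeasure ν]

lemma smear_integrable (hg : Continuous g) (hc : HasCompactSupport g) (x : ℂ) :
    Integrable (fun y => g (x - y)) ν := by
  obtain ⟨C, hC⟩ := hg.bounded_above_of_compact_support hc
  exact Integrable.of_bound (hg.comp (by fun_prop)).aestronglyMeasurable C
    (Filter.Eventually.of_forall fun y => hC _)

lemma smear_continuous (hg : Continuous g) (hc : HasCompactSupport g) :
    Continuous (smear ν g) := by
  rw [smear_eq_convolution]
  exact hc.continuous_convolution_right _ (locallyIntegrable_const 1) hg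

lemma smear_sub (hf : Continuous f) (hfc : HasCompactSupport f) (hg : Continuous g)
    (hgc : HasCompactSupport g) (x : ℂ) :
    smear ν (fun z => f z - g z) x = smear ν f x - smear ν g x :=
  integral_sub (smear_integrable hf hfc x) (smear_integrable hg hgc x)

lemma smear_sq_le (hg : Continuous g) (hc : HasCompactSupport g) (x : ℂ) :
    smear ν g x ^ 2 ≤ smear ν (fun z => g z ^ 2) x := by
  have i1 := smear_integrable (ν := ν) hg hc x
  have i2 : Integrable (fun y => g (x - y) ^ 2) ν := by
    refine (smear_integrable (ν := ν) (hg.mul hg) hc.mul_right x).congr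
      (Filter.Eventually.of_forall fun y => ?_)
    simp [sq]
  set c := smear ν g x with hcc
  have h : 0 ≤ ∫ y, (g (x - y) ^ 2 - 2 * c * g (x - y) + c ^ 2) ∂ν :=
    integral_nonneg fun y => by
      have := sq_nonneg (g (x - y) - c)
      simp only [Pi.zero_apply]
      nlinarith
  have i3 : Integrable (fun y => g (x - y) ^ 2 - 2 * c * g (x - y)) ν := i2.sub (i1.const_mul _)
  rw [integral_add i3 (integrable_const _), integral_sub i2 (i1.const_mul _),
    integral_const_mul] at h
  simp only [integral_const, probReal_univ, smul_eq_mul, one_mul] at h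
  change c ^ 2 ≤ ∫ y, g (x - y) ^ 2 ∂ν
  have e : ∫ y, g (x - y) ∂ν = c := rfl
  rw [e] at h
  nlinarith

lemma integral_smear (hg : Integrable g) : ∫ x, smear ν g x = ∫ x, g x := by
  rw [smear_eq_convolution, integral_convolution _ (integrable_const 1) hg]
  simp

lemma smear_isDiskTest (hν : ∀ᵐ y ∂ν, y ∈ Metric.ball (0 : ℂ) (1 / 4))
    (hgs : ContDiff ℝ (⊤ : ℕ∞) g) (hg : ∀ z, z ∉ Metric.closedBall (0 : ℂ) (1 / 2) → g z = 0) :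
    IsDiskTest (smear ν g) := by
  refine ⟨?_, smear_hasCompactSupport hν hg, ?_⟩
  · rw [smear_eq_convolution]
    exact (hasCompactSupport_of_half hg).contDiff_convolution_right _ (locallyIntegrable_const 1)
      hgs
  · refine (closure_minimal (fun z hz => ?_) Metric.isClosed_closedBall).trans
      (Metric.closedBall_subset_ball (by norm_num : (3 / 4 : ℝ) < 1))
    by_contra h
    exact hz (smear_eq_zero hν hg h)

lemma fderiv_smear (hgs : ContDiff ℝ (⊤ : ℕ∞) g) (hc : HasCompactSupport g) (w : ℂ) :
    (fun x => fderiv ℝ (smear ν g) x w) = smear ν fun z => fderiv ℝ g z w := by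
  ext x
  have hd : Continuous (fderiv ℝ g) := hgs.continuous_fderiv (by simp)
  obtain ⟨C, hC⟩ := hd.bounded_above_of_compact_support (hc.fderiv ℝ)
  have i : Integrable (fun y => fderiv ℝ g (x - y)) ν :=
    Integrable.of_bound (hd.comp (by fun_prop)).aestronglyMeasurable C
      (Filter.Eventually.of_forall fun y => hC _)
  have h := hasFDerivAt_integral_of_dominated_of_fderiv_le (μ := ν) (s := univ) (x₀ := x)
    (F := fun x y => g (x - y)) (F' := fun x y => fderiv ℝ g (x - y)) (bound := fun _ => C)
    univ_mem
    (Filter.Eventually.of_forall fun x => (smear_integrable hgs.continuous hc x).1)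
    (smear_integrable hgs.continuous hc x) i.1
    (Filter.Eventually.of_forall fun y x _ => hC _) (integrable_const C)
    (Filter.Eventually.of_forall fun y x _ =>
      (hasFDerivAt_comp_sub y).2 (hgs.differentiable (by simp) (x - y)).hasFDerivAt)
  refine (DFunLike.congr_fun h.fderiv w).trans ?_
  exact ContinuousLinearMap.integral_apply i w

end smear

/-- The potential of `ν` for the truncated kernel. -/
def potential (ν : Measure ℂ) (ε : ℝ) : ℂ → ℝ := smear ν (kernel ε)

/-- The error with which `potential ν ε` represents `smear ν (kernelMass ε)`. -/
def potentialError (ν : Measure ℂ) (ε : ℝ) (x : ℂ) : ℝ :=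
  smear ν (kernelRest ε) x + hardyWeight x * potential ν ε x

section potential

variable {ν : Measure ℂ} {ε : ℝ}

variable [IsProbabilityMeasure ν]

lemma potential_isDiskTest (hν : ∀ᵐ y ∂ν, y ∈ Metric.ball (0 : ℂ) (1 / 4)) (hε : 0 < ε) :
    IsDiskTest (potential ν ε) :=
  smear_isDiskTest hν (kernel_contDiff hε) fun _ => kernel_eq_zero

lemma potentialError_continuous (hν : ∀ᵐ y ∂ν, y ∈ Metric.ball (0 : ℂ) (1 / 4)) (hε : 0 < ε) :
    Continuous (potentialError ν ε) :=
  (smear_continuous (kernelRest_continuous hε)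
    (hasCompactSupport_of_half fun _ => kernelRest_eq_zero)).add
    (potential_isDiskTest hν hε).weight_mul.continuous

lemma potentialError_hasCompactSupport (hν : ∀ᵐ y ∂ν, y ∈ Metric.ball (0 : ℂ) (1 / 4))
    (hε : 0 < ε) : HasCompactSupport (potentialError ν ε) :=
  (smear_hasCompactSupport hν fun _ => kernelRest_eq_zero).add
    (potential_isDiskTest hν hε).weight_mul.2.1

lemma hardyForm_potential_add (hν : ∀ᵐ y ∂ν, y ∈ Metric.ball (0 : ℂ) (1 / 4)) (hε : 0 < ε)
    {u : ℂ → ℝ} (hu : IsDiskTest u) :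
    hardyForm u (potential ν ε) + ∫ z, u z * potentialError ν ε z
      = ∫ z, u z * smear ν (kernelMass ε) z := by
  have hk := kernel_contDiff hε
  have hkc : HasCompactSupport (kernel ε) := hasCompactSupport_of_half fun _ => kernel_eq_zero
  have hlap : ∀ z, fderiv ℝ (fun y => fderiv ℝ (potential ν ε) y 1) z 1
      + fderiv ℝ (fun y => fderiv ℝ (potential ν ε) y Complex.I) z Complex.I
      = smear ν (kernelRest ε) z - smear ν (kernelMass ε) z := fun z => by
    have hkd : ∀ w : ℂ, ContDiff ℝ (⊤ : ℕ∞) fun z => fderiv ℝ (kernel ε) z w := fun w =>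
      (hk.fderiv_right (m := (⊤ : ℕ∞)) (by simp)).clm_apply contDiff_const
    have hkdc : ∀ w : ℂ, HasCompactSupport fun z => fderiv ℝ (kernel ε) z w := fun w =>
      hkc.fderiv_apply ℝ w
    have e : ∀ w : ℂ, fderiv ℝ (fun y => fderiv ℝ (potential ν ε) y w) z w
        = smear ν (fun z => fderiv ℝ (fun y => fderiv ℝ (kernel ε) y w) z w) z := fun w => by
      rw [potential, fderiv_smear hk hkc]
      exact congrFun (fderiv_smear (hkd w) (hkdc w) w) z
    have i : ∀ w : ℂ, Integrable
        (fun y => fderiv ℝ (fun y => fderiv ℝ (kernel ε) y w) (z - y) w) ν := fun w =>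
      smear_integrable (g := fun x => fderiv ℝ (fun y => fderiv ℝ (kernel ε) y w) x w)
        (((hkd w).continuous_fderiv (by simp)).clm_apply continuous_const)
        ((hkdc w).fderiv_apply ℝ w) z
    rw [e, e, ← smear_sub (kernelRest_continuous hε)
      (hasCompactSupport_of_half fun _ => kernelRest_eq_zero) (kernelMass_continuous hε)
      (hasCompactSupport_of_half fun _ => kernelMass_eq_zero)]
    refine (integral_add (i 1) (i Complex.I)).symm.trans ?_
    exact integral_congr_ae (Filter.Eventually.of_forall fun y => kernel_laplacian hε (z - y))
  have hp := potential_isDiskTest hν hε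
  have iu : Integrable fun z => u z * potentialError ν ε z :=
    (hu.continuous.mul (potentialError_continuous hν hε)).integrable_of_hasCompactSupport
      hu.2.1.mul_right
  have il := hu.mul ((((hp.fderiv_apply 1).fderiv_apply 1).add
    ((hp.fderiv_apply Complex.I).fderiv_apply Complex.I)).neg.sub hp.weight_mul)
  rw [hu.hardyForm_eq_integral hp, ← integral_add il.integrable iu]
  refine integral_congr_ae (Filter.Eventually.of_forall fun z => ?_)
  simp only [hlap, potentialError]
  ring

lemma integral_potential_sq_le (hν : ∀ᵐ y ∂ν, y ∈ Metric.ball (0 : ℂ) (1 / 4)) (hε : 0 < ε)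
    (hε' : ε ≤ 1 / 2) : ∫ z, potential ν ε z ^ 2 ≤ π := by
  have hk := (kernel_contDiff hε).continuous
  have hkc : HasCompactSupport (kernel ε) := hasCompactSupport_of_half fun _ => kernel_eq_zero
  have hp := potential_isDiskTest hν hε
  have hk2 : Continuous fun z => kernel ε z ^ 2 := hk.pow 2
  have hz : ∀ z ∉ Metric.closedBall (0 : ℂ) (1 / 2), kernel ε z ^ 2 = 0 := fun z hz => by
    simp [kernel_eq_zero hz]
  have hk2c : HasCompactSupport fun z => kernel ε z ^ 2 := hasCompactSupport_of_half hz
  have i1 : Integrable fun z => potential ν ε z ^ 2 := by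
    simpa [sq] using (hp.mul hp).integrable
  have i2 : Integrable (smear ν fun z => kernel ε z ^ 2) :=
    (smear_continuous hk2 hk2c).integrable_of_hasCompactSupport (smear_hasCompactSupport hν hz)
  have i3 := hk2.integrable_of_hasCompactSupport (μ := volume) hk2c
  calc ∫ z, potential ν ε z ^ 2 ≤ ∫ z, smear ν (fun z => kernel ε z ^ 2) z :=
        integral_mono i1 i2 fun z => smear_sq_le hk hkc z
    _ = ∫ z, kernel ε z ^ 2 := integral_smear i3
    _ = ∫ z in Metric.ball (0 : ℂ) (1 / 2), kernel ε z ^ 2 := by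
        refine (setIntegral_eq_integral_of_forall_compl_eq_zero fun z hz => ?_).symm
        have : 1 / 2 ≤ ‖z‖ := by simpa using hz
        have : 1 / 4 ≤ ‖z‖ ^ 2 := by nlinarith
        simp [kernel, cutoff_eq_zero this]
    _ ≤ ∫ z in Metric.ball (0 : ℂ) (1 / 2), ‖z‖⁻¹ := by
        refine integral_mono_ae i3.integrableOn (integrableOn_norm_inv _) ?_
        refine ae_restrict_of_ae ?_
        filter_upwards [(measure_singleton (0 : ℂ) : volume {(0 : ℂ)} = 0) |>
          compl_mem_ae_iff.2] with z hz
        exact kernel_sq_le hε hε' hz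
    _ = π := by rw [integral_norm_inv (by norm_num)]; ring

lemma exists_integral_potentialError_sq_le : ∃ K : ℝ, ∀ (ν : Measure ℂ) [IsProbabilityMeasure ν],
    (∀ᵐ y ∂ν, y ∈ Metric.ball (0 : ℂ) (1 / 4)) → ∀ ε : ℝ, 0 < ε → ε ≤ 1 / 2 →
      ∫ z, potentialError ν ε z ^ 2 ≤ K := by
  obtain ⟨M, hM0, hM⟩ := exists_abs_kernelRest_le
  set D : ℝ := volume.real (Metric.closedBall (0 : ℂ) (1 / 2))
  refine ⟨2 * (M ^ 2 * D) + 72 * π, fun ν _ hν ε hε hε' => ?_⟩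
  have hp := potential_isDiskTest hν hε
  have hr := kernelRest_continuous hε
  have hrc : HasCompactSupport (kernelRest ε) :=
    hasCompactSupport_of_half fun _ => kernelRest_eq_zero
  have hr2 : Continuous fun z => kernelRest ε z ^ 2 := hr.pow 2
  have hz : ∀ z ∉ Metric.closedBall (0 : ℂ) (1 / 2), kernelRest ε z ^ 2 = 0 := fun z hz => by
    simp [kernelRest_eq_zero hz]
  have hr2c : HasCompactSupport fun z => kernelRest ε z ^ 2 := hasCompactSupport_of_half hz
  have i1 : Integrable fun z => potential ν ε z ^ 2 := by
    simpa [sq] using (hp.mul hp).integrable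
  have i2 : Integrable (smear ν fun z => kernelRest ε z ^ 2) :=
    (smear_continuous hr2 hr2c).integrable_of_hasCompactSupport (smear_hasCompactSupport hν hz)
  have i3 := hr2.integrable_of_hasCompactSupport (μ := volume) hr2c
  have iP : Integrable fun z => potentialError ν ε z ^ 2 := by
    have hc := potentialError_continuous hν hε
    have := (hc.mul hc).integrable_of_hasCompactSupport (μ := volume)
      (potentialError_hasCompactSupport hν hε).mul_right
    exact this.congr (Filter.Eventually.of_forall fun z => by simp [sq])
  have hrb : ∫ z, kernelRest ε z ^ 2 ≤ M ^ 2 * D := by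
    rw [← setIntegral_eq_integral_of_forall_compl_eq_zero fun z h => hz z h]
    have h := norm_setIntegral_le_of_norm_le_const (μ := (volume : Measure ℂ))
      (s := Metric.closedBall 0 (1 / 2)) (f := fun z => kernelRest ε z ^ 2) (C := M ^ 2)
      measure_closedBall_lt_top fun z _ => by
        rw [norm_pow]
        exact pow_le_pow_left₀ (norm_nonneg _) (hM ε hε hε' z) 2
    exact (le_abs_self _).trans h
  calc ∫ z, potentialError ν ε z ^ 2
      ≤ ∫ z, (2 * smear ν (fun z => kernelRest ε z ^ 2) z + 72 * potential ν ε z ^ 2) := by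
        refine integral_mono iP ((i2.const_mul 2).add (i1.const_mul 72)) fun z => ?_
        have h1 := smear_sq_le (ν := ν) hr hrc z
        have h2 : (hardyWeight z * potential ν ε z) ^ 2 ≤ 36 * potential ν ε z ^ 2 := by
          by_cases hz : z ∈ Metric.closedBall (0 : ℂ) (3 / 4)
          · have hz' : ‖z‖ ≤ 3 / 4 := by simpa using hz
            have hw : hardyWeight z ≤ 6 := by
              rw [hardyWeight, inv_le_comm₀ (pow_pos (by nlinarith [norm_nonneg z]) 2)
                (by norm_num)]
              have : 7 / 16 ≤ 1 - ‖z‖ ^ 2 := by nlinarith [norm_nonneg z]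
              nlinarith
            have hw0 : 0 ≤ hardyWeight z := by unfold hardyWeight; positivity
            rw [mul_pow]
            refine mul_le_mul_of_nonneg_right ?_ (sq_nonneg _)
            nlinarith
          · have : potential ν ε z = 0 := smear_eq_zero hν (fun _ => kernel_eq_zero) hz
            simp [this]
        simp only [potentialError]
        nlinarith [sq_nonneg (smear ν (kernelRest ε) z - hardyWeight z * potential ν ε z)]
    _ = 2 * (∫ z, kernelRest ε z ^ 2) + 72 * ∫ z, potential ν ε z ^ 2 := by
        rw [integral_add (i2.const_mul 2) (i1.const_mul 72), integral_const_mul,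
          integral_const_mul, integral_smear i3]
    _ ≤ _ := by
        have := integral_potential_sq_le hν hε hε'
        linarith

end potential

lemma integrable_mul_of_hasCompactSupport {f g : ℂ → ℝ} (hf : Continuous f)
    (hfc : HasCompactSupport f) (hg : Continuous g) : Integrable fun z => f z * g z :=
  (hf.mul hg).integrable_of_hasCompactSupport hfc.mul_right

lemma integrable_sq_of_hasCompactSupport {f : ℂ → ℝ} (hf : Continuous f)
    (hfc : HasCompactSupport f) : Integrable fun z => f z ^ 2 := by
  simpa [sq] using integrable_mul_of_hasCompactSupport hf hfc hf

lemma two_mul_abs_integral_mul_le {f g : ℂ → ℝ} (hf : Continuous f) (hfc : HasCompactSupport f)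
    (hg : Continuous g) (hgc : HasCompactSupport g) :
    2 * |∫ z, f z * g z| ≤ (∫ z, f z ^ 2) + ∫ z, g z ^ 2 := by
  have i1 := integrable_sq_of_hasCompactSupport hf hfc
  have i2 := integrable_sq_of_hasCompactSupport hg hgc
  have i3 := integrable_mul_of_hasCompactSupport hf hfc hg
  rw [← integral_add i1 i2, ← abs_two (α := ℝ), ← abs_mul, ← integral_const_mul]
  refine (abs_integral_le_integral_abs).trans (integral_mono (i3.const_mul 2).abs (i1.add i2)
    fun z => ?_)
  simp only
  rw [abs_le]
  constructor <;> nlinarith [sq_nonneg (f z - g z), sq_nonneg (f z + g z)]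

lemma integral_add_sq_le {f g : ℂ → ℝ} (hf : Continuous f) (hfc : HasCompactSupport f)
    (hg : Continuous g) (hgc : HasCompactSupport g) :
    ∫ z, (f z + g z) ^ 2 ≤ 2 * (∫ z, f z ^ 2) + 2 * ∫ z, g z ^ 2 := by
  have i1 := integrable_sq_of_hasCompactSupport hf hfc
  have i2 := integrable_sq_of_hasCompactSupport hg hgc
  rw [← integral_const_mul, ← integral_const_mul,
    ← integral_add (i1.const_mul 2) (i2.const_mul 2)]
  refine integral_mono (integrable_sq_of_hasCompactSupport (f := fun z => f z + g z)
    (hf.add hg) (hfc.add hgc)) ((i1.const_mul 2).add (i2.const_mul 2)) fun z => ?_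
  simp only
  nlinarith [sq_nonneg (f z - g z)]

lemma integral_mul_smear_kernelMass_le {ν : Measure ℂ} [IsProbabilityMeasure ν]
    (hν : ∀ᵐ y ∂ν, y ∈ Metric.ball (0 : ℂ) (1 / 4)) {ε : ℝ} (hε : 0 < ε) {h : ℂ → ℝ} {c : ℝ}
    (hh : Continuous h) (hhc : HasCompactSupport h) (hc : 0 ≤ c) (hle : ∀ z, h z ≤ c) :
    ∫ z, h z * smear ν (kernelMass ε) z ≤ c := by
  have hsc : HasCompactSupport (kernelMass ε) :=
    hasCompactSupport_of_half fun _ => kernelMass_eq_zero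
  have hs : Continuous (smear ν (kernelMass ε)) := smear_continuous (kernelMass_continuous hε) hsc
  have hi : Integrable (smear ν (kernelMass ε)) :=
    hs.integrable_of_hasCompactSupport (smear_hasCompactSupport hν fun _ => kernelMass_eq_zero)
  calc ∫ z, h z * smear ν (kernelMass ε) z ≤ ∫ z, c * smear ν (kernelMass ε) z :=
        integral_mono (integrable_mul_of_hasCompactSupport hh hhc hs) (hi.const_mul c) fun z =>
          mul_le_mul_of_nonneg_right (hle z) (smear_nonneg (kernelMass_nonneg ε) z)
    _ = c * ∫ z, kernelMass ε z := by
        rw [integral_const_mul, integral_smear (kernelMass_integrable hε)]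
    _ ≤ c := mul_le_of_le_one_right hc (integral_kernelMass_le hε)

/-- The two-measure estimate: pairing a function of unit energy with two smeared masses. -/
lemma exists_sq_pairing_le : ∃ K : ℝ, ∀ (ν μ : Measure ℂ) [IsProbabilityMeasure ν]
    [IsProbabilityMeasure μ], (∀ᵐ y ∂ν, y ∈ Metric.ball (0 : ℂ) (1 / 4)) →
    (∀ᵐ y ∂μ, y ∈ Metric.ball (0 : ℂ) (1 / 4)) → ∀ ε a b : ℝ, 0 < ε → ε ≤ 1 / 2 →
    0 ≤ a → 0 ≤ b → (∀ x, potential ν ε x ≤ a) → (∀ x, potential μ ε x ≤ b) →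
    ∀ u : ℂ → ℝ, IsDiskTest u → hardyForm u u ≤ 1 →
      ((∫ z, u z * smear ν (kernelMass ε) z) + ∫ z, u z * smear μ (kernelMass ε) z) ^ 2
        ≤ 3 * a + b + K := by
  obtain ⟨K, hK⟩ := exists_integral_potentialError_sq_le
  refine ⟨3 * π + 7 * K, fun ν μ _ _ hν hμ ε a b hε hε' ha hb hνa hμb u hu hu1 => ?_⟩
  set h := potential ν ε
  set g := potential μ ε
  set P := potentialError ν ε
  set Q := potentialError μ ε
  set S := smear ν (kernelMass ε)
  set T := smear μ (kernelMass ε)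
  have hh : IsDiskTest h := potential_isDiskTest hν hε
  have hg : IsDiskTest g := potential_isDiskTest hμ hε
  have hP : Continuous P := potentialError_continuous hν hε
  have hQ : Continuous Q := potentialError_continuous hμ hε
  have hPc : HasCompactSupport P := potentialError_hasCompactSupport hν hε
  have hQc : HasCompactSupport Q := potentialError_hasCompactSupport hμ hε
  have hsc : HasCompactSupport (kernelMass ε) :=
    hasCompactSupport_of_half fun _ => kernelMass_eq_zero
  have hS : Continuous S := smear_continuous (kernelMass_continuous hε) hsc
  have hT : Continuous T := smear_continuous (kernelMass_continuous hε) hsc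
  have hp := hh.add hg
  have mulAdd : ∀ {v f k : ℂ → ℝ}, IsDiskTest v → Continuous f → Continuous k →
      ∫ z, v z * (f z + k z) = (∫ z, v z * f z) + ∫ z, v z * k z := fun hv hf hk => by
    rw [← integral_add (integrable_mul_of_hasCompactSupport hv.continuous hv.2.1 hf)
      (integrable_mul_of_hasCompactSupport hv.continuous hv.2.1 hk)]
    simp only [mul_add]
  have addMul : ∀ {f : ℂ → ℝ}, Continuous f →
      ∫ z, (h z + g z) * f z = (∫ z, h z * f z) + ∫ z, g z * f z := fun hf => by
    rw [← integral_add (integrable_mul_of_hasCompactSupport hh.continuous hh.2.1 hf)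
      (integrable_mul_of_hasCompactSupport hg.continuous hg.2.1 hf)]
    simp only [add_mul]
  have main := hu.sq_dual_le hp (P := fun z => P z + Q z) (hP.add hQ) (hPc.add hQc) hu1
  rw [hu.hardyForm_add_right hh hg, mulAdd hu hP hQ, hp.hardyForm_add_right hh hg] at main
  have eu1 : hardyForm u h + ∫ z, u z * P z = ∫ z, u z * S z := hardyForm_potential_add hν hε hu
  have eu2 : hardyForm u g + ∫ z, u z * Q z = ∫ z, u z * T z := hardyForm_potential_add hμ hε hu
  have ep1 := hardyForm_potential_add hν hε hp
  have ep2 := hardyForm_potential_add hμ hε hp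
  change hardyForm _ h + ∫ z, _ * P z = ∫ z, _ * S z at ep1
  change hardyForm _ g + ∫ z, _ * Q z = ∫ z, _ * T z at ep2
  rw [addMul hS] at ep1
  rw [addMul hT] at ep2
  have e1 : hardyForm g h + ∫ z, g z * P z = ∫ z, g z * S z := hardyForm_potential_add hν hε hg
  have e2 : hardyForm h g + ∫ z, h z * Q z = ∫ z, h z * T z := hardyForm_potential_add hμ hε hh
  rw [hardyForm_comm] at e1
  have b1 : ∫ z, h z * S z ≤ a :=
    integral_mul_smear_kernelMass_le hν hε hh.continuous hh.2.1 ha hνa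
  have b2 : ∫ z, h z * T z ≤ a :=
    integral_mul_smear_kernelMass_le hμ hε hh.continuous hh.2.1 ha hνa
  have b3 : ∫ z, g z * T z ≤ b :=
    integral_mul_smear_kernelMass_le hμ hε hg.continuous hg.2.1 hb hμb
  have c1 := two_mul_abs_integral_mul_le hh.continuous hh.2.1 hQ hQc
  have c2 := two_mul_abs_integral_mul_le hg.continuous hg.2.1 hP hPc
  have c3 := two_mul_abs_integral_mul_le hp.continuous hp.2.1 (hP.add hQ) (hPc.add hQc)
  have c4 := integral_add_sq_le hh.continuous hh.2.1 hg.continuous hg.2.1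
  have c5 := integral_add_sq_le hP hPc hQ hQc
  have d1 : ∫ z, h z ^ 2 ≤ π := integral_potential_sq_le hν hε hε'
  have d2 : ∫ z, g z ^ 2 ≤ π := integral_potential_sq_le hμ hε hε'
  have d3 : ∫ z, P z ^ 2 ≤ K := hK ν hν ε hε hε'
  have d4 : ∫ z, Q z ^ 2 ≤ K := hK μ hμ ε hε hε'
  have f1 := neg_abs_le (∫ z, h z * Q z)
  have f2 := le_abs_self (∫ z, g z * P z)
  have f3 := le_abs_self (∫ z, (h z + g z) * (P z + Q z))
  have e3 := mulAdd hp hP hQ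
  simp only [Pi.add_apply] at c3
  rw [show (∫ z, u z * S z) + ∫ z, u z * T z
    = hardyForm u h + hardyForm u g + ((∫ z, u z * P z) + ∫ z, u z * Q z) by linarith]
  refine main.trans ?_
  linarith

lemma integral_cond_eq (E : Set ℂ) (f : ℂ → ℝ) :
    ∫ y, f y ∂(ProbabilityTheory.cond volume E) = (volume.real E)⁻¹ * ∫ y in E, f y := by
  rw [ProbabilityTheory.cond, integral_smul_measure, ENNReal.toReal_inv, smul_eq_mul, Measure.real]

section level

variable {E : Set ℂ}

lemma volume_ne_top_of_subset (hE4 : E ⊆ Metric.ball 0 (1 / 4)) : volume E ≠ ∞ :=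
  ((measure_mono hE4).trans_lt measure_ball_lt_top).ne

lemma volumeReal_pos (hE4 : E ⊆ Metric.ball 0 (1 / 4)) (hE0 : volume E ≠ 0) :
    0 < volume.real E :=
  ENNReal.toReal_pos hE0 (volume_ne_top_of_subset hE4)

lemma volumeReal_le_one (hE4 : E ⊆ Metric.ball 0 (1 / 4)) : volume.real E ≤ 1 := by
  have h : volume.real E ≤ volume.real (Metric.ball (0 : ℂ) (1 / 4)) :=
    measureReal_mono hE4 measure_ball_lt_top.ne
  have h2 : volume.real (Metric.ball (0 : ℂ) (1 / 4)) = (1 / 4) ^ 2 * π := by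
    simp [Measure.real, Complex.volume_ball]
  have := pi_lt_four
  linarith

lemma potential_cond_le (hE4 : E ⊆ Metric.ball 0 (1 / 4))
    (hE0 : volume E ≠ 0) {ε : ℝ} (hε : 0 < ε) (hε' : ε ≤ 1 / 2) (x : ℂ) :
    potential (ProbabilityTheory.cond volume E) ε x
      ≤ (4 * π)⁻¹ * -log (volume.real E) + 2 := by
  have hm := volumeReal_pos hE4 hE0
  have hm1 := volumeReal_le_one hE4
  set m := volume.real E with hmdef
  set r := √m with hr
  have hr0 : 0 < r := sqrt_pos.2 hm
  have hr1 : r ≤ 1 := sqrt_le_one.2 hm1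
  have hrr : r * r = m := mul_self_sqrt hm.le
  have hlog : log r = log m / 2 := log_sqrt hm.le
  set f : ℂ → ℝ := (Metric.ball (0 : ℂ) r).indicator fun z => ‖z‖⁻¹ with hf
  have hf0 : ∀ z, 0 ≤ f z := fun z => indicator_nonneg (fun z _ => by positivity) z
  have hfi : Integrable f := (integrable_indicator_iff measurableSet_ball).2 (integrableOn_norm_inv r)
  have hfi' : Integrable fun y => f (x - y) := hfi.comp_sub_left x
  have hfint : ∫ y, f (x - y) = 2 * π * r := by
    rw [integral_sub_left_eq_self f, hf, integral_indicator measurableSet_ball,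
      integral_norm_inv hr0.le]
  have hEfin := volume_ne_top_of_subset hE4
  have hpt : ∀ y, y ≠ x → kernel ε (x - y) ≤ (2 * π)⁻¹ * ((-log r + 1) + r * f (x - y)) :=
    fun y hy => by
    refine (kernel_le_log_add hε hε' hr0 hr1 (sub_ne_zero.2 hy.symm)).trans ?_
    refine mul_le_mul_of_nonneg_left ?_ (by positivity)
    rw [add_assoc]
    gcongr
    by_cases h : x - y ∈ Metric.ball (0 : ℂ) r
    · rw [hf, indicator_of_mem h]
      linarith
    · have h' : r ≤ ‖x - y‖ := by simpa using h
      have : r * ‖x - y‖⁻¹ ≤ 1 := by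
        rw [mul_inv_le_iff₀ (hr0.trans_le h'), one_mul]
        exact h'
      have := mul_nonneg hr0.le (hf0 (x - y))
      linarith
  have hki : Integrable fun y => kernel ε (x - y) :=
    ((kernel_contDiff hε).continuous.integrable_of_hasCompactSupport
      (hasCompactSupport_of_half fun _ => kernel_eq_zero)).comp_sub_left x
  have hci : IntegrableOn (fun _ : ℂ => -log r + 1) E := integrableOn_const hEfin
  have hker : ∫ y in E, kernel ε (x - y) ≤ (2 * π)⁻¹ * ((-log r + 1) * m + r * (2 * π * r)) := by
    calc ∫ y in E, kernel ε (x - y)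
        ≤ ∫ y in E, (2 * π)⁻¹ * ((-log r + 1) + r * f (x - y)) := by
          refine integral_mono_ae hki.integrableOn
            ((hci.add (hfi'.integrableOn.const_mul r)).const_mul _) (ae_restrict_of_ae ?_)
          filter_upwards [compl_mem_ae_iff.2 (measure_singleton x)] with y hy
          exact hpt y hy
      _ = (2 * π)⁻¹ * ((-log r + 1) * m + r * ∫ y in E, f (x - y)) := by
          rw [integral_const_mul, integral_add hci (hfi'.integrableOn.const_mul r),
            integral_const_mul, setIntegral_const, smul_eq_mul, mul_comm (volume.real E)]
      _ ≤ _ := by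
          have := setIntegral_le_integral (s := E) hfi'
            (Filter.Eventually.of_forall fun y => hf0 (x - y))
          rw [hfint] at this
          gcongr
  have e : potential (ProbabilityTheory.cond volume E) ε x = m⁻¹ * ∫ y in E, kernel ε (x - y) :=
    integral_cond_eq E _
  rw [e]
  refine (mul_le_mul_of_nonneg_left hker (by positivity)).trans ?_
  have h1 : (2 * π)⁻¹ ≤ 1 := inv_le_one_of_one_le₀ (by linarith [pi_gt_three])
  have h2 : m⁻¹ * ((2 * π)⁻¹ * ((-log r + 1) * m + r * (2 * π * r)))
      = (4 * π)⁻¹ * -log m + ((2 * π)⁻¹ + 1) := by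
    rw [show r * (2 * π * r) = 2 * π * m by rw [← hrr]; ring, hlog]
    field_simp
    ring
  rw [h2]
  linarith

end level

lemma tendsto_integral_mul_smear (ν : Measure ℂ) [IsProbabilityMeasure ν] {u : ℂ → ℝ}
    (hu : Continuous u) (huc : HasCompactSupport u) :
    Tendsto (fun ε => ∫ x, u x * smear ν (kernelMass ε) x) (nhdsWithin 0 (Ioi 0))
      (nhds (∫ y, u y ∂ν)) := by
  obtain ⟨C, hC⟩ := hu.bounded_above_of_compact_support huc
  have hui := hu.integrable_of_hasCompactSupport (μ := volume) huc
  have swap : ∀ ε : ℝ, 0 < ε → ∫ y, (∫ x, u x * kernelMass ε (x - y)) ∂ν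
      = ∫ x, u x * smear ν (kernelMass ε) x := fun ε hε => by
    have hkc := kernelMass_continuous hε
    obtain ⟨D, hD⟩ := hkc.bounded_above_of_compact_support
      (hasCompactSupport_of_half fun _ => kernelMass_eq_zero)
    rw [integral_integral_swap]
    · simp only [integral_const_mul]
      rfl
    · have hb : Integrable (fun p : ℂ × ℂ => D * ‖u p.2‖) (ν.prod volume) :=
        (integrable_const D).mul_prod hui.norm
      have hm : Continuous (Function.uncurry fun y x => u x * kernelMass ε (x - y)) :=
        (hu.comp continuous_snd).mul (hkc.comp (continuous_snd.sub continuous_fst))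
      refine hb.mono' hm.aestronglyMeasurable (Filter.Eventually.of_forall fun p => ?_)
      simp only [Function.uncurry, norm_mul]
      rw [mul_comm]
      gcongr
      exact hD _
  have hlim : Tendsto (fun ε => ∫ y, (∫ x, u x * kernelMass ε (x - y)) ∂ν)
      (nhdsWithin 0 (Ioi 0)) (nhds (∫ y, u y ∂ν)) := by
    refine tendsto_integral_filter_of_dominated_convergence (fun _ => C) ?_ ?_
      (integrable_const C) (Filter.Eventually.of_forall fun y =>
        tendsto_integral_mul_kernelMass hu y)
    · filter_upwards [self_mem_nhdsWithin] with ε hε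
      have hkc := kernelMass_continuous hε
      have hm : Continuous (Function.uncurry fun y x => u x * kernelMass ε (x - y)) :=
        (hu.comp continuous_snd).mul (hkc.comp (continuous_snd.sub continuous_fst))
      exact (hm.stronglyMeasurable.integral_prod_right (ν := volume)).aestronglyMeasurable
    · filter_upwards [self_mem_nhdsWithin] with ε hε
      refine Filter.Eventually.of_forall fun y => ?_
      have hi : Integrable fun x => C * kernelMass ε (x - y) :=
        ((kernelMass_integrable hε).comp_sub_right y).const_mul C
      refine (norm_integral_le_of_norm_le hi (Filter.Eventually.of_forall fun x => ?_)).trans ?_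
      · rw [norm_mul, Real.norm_of_nonneg (kernelMass_nonneg ε _)]
        exact mul_le_mul_of_nonneg_right (hC x) (kernelMass_nonneg ε _)
      · rw [integral_const_mul, integral_sub_right_eq_self (kernelMass ε)]
        exact mul_le_of_le_one_right ((norm_nonneg _).trans (hC 0)) (integral_kernelMass_le hε)
  refine hlim.congr' ?_
  filter_upwards [self_mem_nhdsWithin] with ε hε using swap ε hε

lemma le_integral_cond {E : Set ℂ} (hE : MeasurableSet E) (hE4 : E ⊆ Metric.ball 0 (1 / 4))
    (hE0 : volume E ≠ 0) {u : ℂ → ℝ} (hu : Integrable u) {s : ℝ} (hs : ∀ x ∈ E, s ≤ u x) :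
    s ≤ ∫ y, u y ∂(ProbabilityTheory.cond volume E) := by
  have hm := volumeReal_pos hE4 hE0
  rw [integral_cond_eq, le_inv_mul_iff₀ hm]
  have := setIntegral_mono_on (f := fun _ => s)
    (integrableOn_const (volume_ne_top_of_subset hE4)) hu.integrableOn hE hs
  simpa using this

/-- Joint bound for the sizes of two superlevel sets of a function of unit energy. -/
lemma exists_sq_add_le : ∃ K : ℝ, ∀ u : ℂ → ℝ, IsDiskTest u → hardyForm u u ≤ 1 →
    ∀ E F : Set ℂ, MeasurableSet E → MeasurableSet F → E ⊆ Metric.ball 0 (1 / 4) →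
    F ⊆ Metric.ball 0 (1 / 4) → volume E ≠ 0 → volume F ≠ 0 → ∀ s t : ℝ, 0 ≤ s → 0 ≤ t →
    (∀ x ∈ E, s ≤ u x) → (∀ x ∈ F, t ≤ u x) →
    4 * π * (s + t) ^ 2 ≤ -3 * log (volume.real E) - log (volume.real F) + K := by
  obtain ⟨K, hK⟩ := exists_sq_pairing_le
  refine ⟨4 * π * (8 + K), fun u hu hu1 E F hE hF hE4 hF4 hE0 hF0 s t hs ht hsE htF => ?_⟩
  have := ProbabilityTheory.cond_isProbabilityMeasure_of_finite hE0 (volume_ne_top_of_subset hE4)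
  have := ProbabilityTheory.cond_isProbabilityMeasure_of_finite hF0 (volume_ne_top_of_subset hF4)
  set ν := ProbabilityTheory.cond volume E
  set μ := ProbabilityTheory.cond volume F
  have hν : ∀ᵐ y ∂ν, y ∈ Metric.ball (0 : ℂ) (1 / 4) :=
    ProbabilityTheory.ae_cond_of_forall_mem hE hE4
  have hμ : ∀ᵐ y ∂μ, y ∈ Metric.ball (0 : ℂ) (1 / 4) :=
    ProbabilityTheory.ae_cond_of_forall_mem hF hF4
  have hnn : ∀ {G : Set ℂ}, G ⊆ Metric.ball 0 (1 / 4) →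
      0 ≤ (4 * π)⁻¹ * -log (volume.real G) + 2 := fun hG => by
    have := log_nonpos measureReal_nonneg (volumeReal_le_one hG)
    have : 0 ≤ (4 * π)⁻¹ * -log (volume.real _) := mul_nonneg (by positivity) (neg_nonneg.2 this)
    linarith
  have hlim := ((tendsto_integral_mul_smear ν hu.continuous hu.2.1).add
    (tendsto_integral_mul_smear μ hu.continuous hu.2.1)).pow 2
  have hev : ∀ᶠ ε in nhdsWithin (0 : ℝ) (Ioi 0),
      ((∫ z, u z * smear ν (kernelMass ε) z) + ∫ z, u z * smear μ (kernelMass ε) z) ^ 2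
        ≤ 3 * ((4 * π)⁻¹ * -log (volume.real E) + 2)
          + ((4 * π)⁻¹ * -log (volume.real F) + 2) + K := by
    filter_upwards [Ioc_mem_nhdsGT (show (0 : ℝ) < 1 / 2 by norm_num)] with ε hε
    exact hK ν μ hν hμ ε _ _ hε.1 hε.2 (hnn hE4) (hnn hF4)
      (potential_cond_le hE4 hE0 hε.1 hε.2) (potential_cond_le hF4 hF0 hε.1 hε.2) u hu hu1
  have hfin := le_of_tendsto hlim hev
  have h1 := le_integral_cond hE hE4 hE0 hu.integrable hsE
  have h2 := le_integral_cond hF hF4 hF0 hu.integrable htF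
  have h3 : (s + t) ^ 2 ≤ ((∫ y, u y ∂ν) + ∫ y, u y ∂μ) ^ 2 :=
    pow_le_pow_left₀ (add_nonneg hs ht) (add_le_add h1 h2) 2
  have h4 := mul_le_mul_of_nonneg_left (h3.trans hfin) (show 0 ≤ 4 * π by positivity)
  refine h4.trans (le_of_eq ?_)
  field_simp
  ring

lemma exp_neg_abs_le (x : ℝ) : exp (-|x|) ≤ 2 * (1 + x ^ 2)⁻¹ := by
  have h := quadratic_le_exp_of_nonneg (abs_nonneg x)
  have h1 : (1 + x ^ 2) / 2 ≤ exp |x| := by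
    have := abs_nonneg x
    rw [sq_abs] at h
    linarith
  rw [exp_neg]
  calc (exp |x|)⁻¹ ≤ ((1 + x ^ 2) / 2)⁻¹ := inv_anti₀ (by positivity) h1
    _ = 2 * (1 + x ^ 2)⁻¹ := by rw [inv_div, div_eq_mul_inv]

lemma lintegral_mul_exp_neg_mul_abs_sub_le {s : ℝ} (hs : 0 < s) (a : ℝ) :
    ∫⁻ t : ℝ, ENNReal.ofReal (s * exp (-(s * |t - a|))) ≤ ENNReal.ofReal (2 * π) := by
  have hi : Integrable fun t : ℝ => s * (2 * (1 + (s * (t - a)) ^ 2)⁻¹) :=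
    (((integrable_inv_one_add_sq.comp_mul_left' hs.ne').comp_sub_right a).const_mul 2).const_mul s
  have hv : ∫ t : ℝ, s * (2 * (1 + (s * (t - a)) ^ 2)⁻¹) = 2 * π := by
    rw [integral_const_mul, integral_const_mul,
      integral_sub_right_eq_self (fun t : ℝ => (1 + (s * t) ^ 2)⁻¹) a,
      Measure.integral_comp_mul_left (fun t : ℝ => (1 + t ^ 2)⁻¹) s,
      integral_univ_inv_one_add_sq, abs_of_pos (inv_pos.2 hs), smul_eq_mul]
    field_simp
  rw [← hv, ofReal_integral_eq_lintegral_ofReal hi (ae_of_all _ fun t => by positivity)]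
  refine lintegral_mono fun t => ENNReal.ofReal_le_ofReal ?_
  have h := exp_neg_abs_le (s * (t - a))
  rw [abs_mul, abs_of_pos hs] at h
  gcongr

/-- A decay estimate on `m` forces the weighted tail integral to be bounded. -/
lemma exists_lintegral_mul_le (K : ℝ) : ∃ C : ℝ, ∀ m : ℝ → ℝ, (∀ t, 0 ≤ m t) →
    (∀ s t, 1 ≤ s → 1 ≤ t → 0 < m s → 0 < m t →
      3 * log (m s) + log (m t) ≤ K - 8 * π * s * (t - s)) →
    ∫⁻ t in Ioi 1, ENNReal.ofReal (t * m t) ≤ ENNReal.ofReal C := by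
  refine ⟨exp ((K + 3 * log 2) / 4) * (2 * π) + exp ((K + 3 * log 2) / 4) * (2 * π),
    fun m hm0 hm => ?_⟩
  set A := exp ((K + 3 * log 2) / 4) with hA
  have hA0 : 0 < A := exp_pos _
  by_cases hz : ∀ t, 1 ≤ t → m t = 0
  · rw [setLIntegral_congr_fun (g := fun _ => 0) measurableSet_Ioi fun t ht => by
      simp [hz t (le_of_lt ht)]]
    simp
  push Not at hz
  obtain ⟨t₁, ht₁, hmt₁⟩ := hz
  have hbdd : BddAbove (m '' Ici 1) := by
    refine ⟨exp (K / 4), ?_⟩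
    rintro _ ⟨t, ht, rfl⟩
    rcases (hm0 t).eq_or_lt with h | h
    · rw [← h]; positivity
    · have := hm t t ht ht h h
      rw [← log_le_iff_le_exp h]
      simp only [sub_self, mul_zero, sub_zero] at this
      linarith
  have hS : 0 < sSup (m '' Ici 1) :=
    ((hm0 t₁).lt_of_ne' hmt₁).trans_le (le_csSup hbdd ⟨t₁, ht₁, rfl⟩)
  obtain ⟨_, ⟨s, hs, rfl⟩, hsm⟩ := exists_lt_of_lt_csSup (s := m '' Ici 1) ⟨_, t₁, ht₁, rfl⟩
    (half_lt_self hS)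
  have hs1 : 1 ≤ s := hs
  have hms : 0 < m s := (half_pos hS).trans hsm
  have hle : ∀ t, 1 ≤ t → m t ≤ 2 * m s := fun t ht => by
    have := le_csSup hbdd ⟨t, ht, rfl⟩
    linarith
  have hl2 : 0 ≤ log 2 := log_nonneg (by norm_num)
  have hpi := pi_gt_three
  have hpt : ∀ t, 1 < t → t * m t ≤ A * (s * exp (-(s * |t - s|))) + A * (s * exp (-(s * |t - 0|))) :=
      fun t ht => by
    rcases (hm0 t).eq_or_lt with h | h
    · rw [← h, mul_zero]; positivity
    have hlog : log (m t) ≤ log 2 + log (m s) := by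
      rw [← log_mul two_ne_zero hms.ne']
      exact log_le_log h (hle t ht.le)
    rcases le_total s t with hst | hst
    · have h1 := hm s t hs1 ht.le hms h
      have h2 : log (m t) ≤ (K + 3 * log 2) / 4 + -(2 * π * s * (t - s)) := by linarith
      have h3 : m t ≤ A * exp (-(2 * π * s * (t - s))) := by
        rw [hA, ← exp_add]
        exact (log_le_iff_le_exp h).1 h2
      have h4 : t ≤ s * exp (s * (t - s)) := by
        have h0 := mul_le_mul_of_nonneg_left (add_one_le_exp (s * (t - s))) (by linarith : 0 ≤ s)
        have h0' : 0 ≤ (s * s - 1) * (t - s) := mul_nonneg (by nlinarith) (by linarith)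
        linarith
      have h5 : t * m t ≤ A * (s * exp (-(s * |t - s|))) := by
        rw [abs_of_nonneg (sub_nonneg.2 hst)]
        calc t * m t ≤ (s * exp (s * (t - s))) * (A * exp (-(2 * π * s * (t - s)))) := by gcongr
          _ = A * (s * exp (s * (t - s) + -(2 * π * s * (t - s)))) := by rw [exp_add]; ring
          _ ≤ _ := by
            gcongr
            have : 0 ≤ s * (t - s) := mul_nonneg (by linarith) (by linarith)
            nlinarith
      exact h5.trans (le_add_of_nonneg_right (by positivity))
    · have h1 := hm t s ht.le hs1 h hms
      have h2 : log (m t) ≤ (K + 3 * log 2) / 4 + -(2 * π * t * (s - t)) := by linarith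
      have h3 : m t ≤ A * exp (-(2 * π * t * (s - t))) := by
        rw [hA, ← exp_add]
        exact (log_le_iff_le_exp h).1 h2
      have h4 : t * m t ≤ s * (A * exp (-(2 * π * t * (s - t)))) := by gcongr
      have h5 : exp (-(2 * π * t * (s - t)))
          ≤ exp (-(s * |t - s|)) + exp (-(s * |t - 0|)) := by
        rw [abs_of_nonpos (sub_nonpos.2 hst), sub_zero, abs_of_pos (by linarith : 0 < t), neg_sub]
        rcases le_total (s / 2) t with hh | hh
        · refine le_add_of_le_of_nonneg (exp_le_exp.2 (neg_le_neg ?_)) (exp_pos _).le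
          gcongr
          nlinarith
        · refine le_add_of_nonneg_of_le (exp_pos _).le (exp_le_exp.2 (neg_le_neg ?_))
          have : s * t ≤ 2 * (t * (s - t)) := by nlinarith
          have h0 : 0 ≤ t * (s - t) := mul_nonneg (by linarith) (by linarith)
          nlinarith
      calc t * m t ≤ s * (A * exp (-(2 * π * t * (s - t)))) := h4
        _ ≤ s * (A * (exp (-(s * |t - s|)) + exp (-(s * |t - 0|)))) := by gcongr
        _ = _ := by ring
  have hs0 : 0 < s := by linarith
  calc ∫⁻ t in Ioi 1, ENNReal.ofReal (t * m t)
      ≤ ∫⁻ t in Ioi 1, (ENNReal.ofReal A * ENNReal.ofReal (s * exp (-(s * |t - s|)))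
          + ENNReal.ofReal A * ENNReal.ofReal (s * exp (-(s * |t - 0|)))) := by
        refine setLIntegral_mono' measurableSet_Ioi fun t ht => ?_
        rw [← ENNReal.ofReal_mul hA0.le, ← ENNReal.ofReal_mul hA0.le,
          ← ENNReal.ofReal_add (by positivity) (by positivity)]
        exact ENNReal.ofReal_le_ofReal (hpt t ht)
    _ ≤ ∫⁻ t, (ENNReal.ofReal A * ENNReal.ofReal (s * exp (-(s * |t - s|)))
          + ENNReal.ofReal A * ENNReal.ofReal (s * exp (-(s * |t - 0|)))) :=
        setLIntegral_le_lintegral _ _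
    _ = ENNReal.ofReal A * (∫⁻ t, ENNReal.ofReal (s * exp (-(s * |t - s|))))
          + ENNReal.ofReal A * ∫⁻ t, ENNReal.ofReal (s * exp (-(s * |t - 0|))) := by
        rw [lintegral_add_left (by fun_prop), lintegral_const_mul _ (by fun_prop),
          lintegral_const_mul _ (by fun_prop)]
    _ ≤ _ := by
        rw [ENNReal.ofReal_add (by positivity) (by positivity), ENNReal.ofReal_mul hA0.le]
        gcongr
        · exact lintegral_mul_exp_neg_mul_abs_sub_le hs0 s
        · exact lintegral_mul_exp_neg_mul_abs_sub_le hs0 0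

lemma IsDiskTest.hardyForm_neg {u : ℂ → ℝ} :
    hardyForm (fun z => -u z) (fun z => -u z) = hardyForm u u := by
  have e : ∀ z, fderiv ℝ (fun z => -u z) z = -fderiv ℝ u z := fun z => fderiv_fun_neg
  simp only [hardyForm, e]
  simp

lemma lintegral_exp_sq_posPart_le {α : Type*} [MeasurableSpace α] (ν : Measure α) {f : α → ℝ}
    (hf : Measurable f) (hf0 : ∀ x, 0 ≤ f x) :
    ∫⁻ x, ENNReal.ofReal (exp (4 * π * f x ^ 2)) ∂ν
      ≤ (∫⁻ t in Ioi 1, ν {x | t < f x} * ENNReal.ofReal (8 * π * t * exp (4 * π * t ^ 2)))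
        + ν univ * ENNReal.ofReal (exp (4 * π)) := by
  have hder : ∀ t : ℝ, HasDerivAt (fun t => exp (4 * π * t ^ 2))
      (8 * π * t * exp (4 * π * t ^ 2)) t := fun t => by
    convert ((hasDerivAt_pow 2 t).const_mul (4 * π)).exp using 1
    simp; ring
  have hc : Continuous fun t : ℝ => 8 * π * t * exp (4 * π * t ^ 2) := by fun_prop
  have hprim : ∀ a b : ℝ, ∫ t in a..b, 8 * π * t * exp (4 * π * t ^ 2)
      = exp (4 * π * b ^ 2) - exp (4 * π * a ^ 2) := fun a b =>
    intervalIntegral.integral_eq_sub_of_hasDerivAt (fun t _ => hder t) (hc.intervalIntegrable a b)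
  have hlc := lintegral_comp_eq_lintegral_meas_lt_mul ν (f := fun x => max (f x - 1) 0)
    (g := fun t => 8 * π * (t + 1) * exp (4 * π * (t + 1) ^ 2))
    (ae_of_all _ fun x => le_max_right _ _) ((hf.sub_const 1).max measurable_const).aemeasurable
    (fun t _ => (hc.comp (continuous_add_const 1)).intervalIntegrable 0 t)
    ((ae_restrict_iff' measurableSet_Ioi).2 (ae_of_all _ fun t (ht : 0 < t) => by positivity))
  have hshift : ∫⁻ t in Ioi 0, ν {x | t < max (f x - 1) 0}
        * ENNReal.ofReal (8 * π * (t + 1) * exp (4 * π * (t + 1) ^ 2))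
      = ∫⁻ t in Ioi 1, ν {x | t < f x} * ENNReal.ofReal (8 * π * t * exp (4 * π * t ^ 2)) := by
    have hmp := (measurePreserving_add_right (volume : Measure ℝ) 1).setLIntegral_comp_preimage_emb
      (MeasurableEquiv.addRight (1 : ℝ)).measurableEmbedding
      (fun t => ν {x | t < f x} * ENNReal.ofReal (8 * π * t * exp (4 * π * t ^ 2))) (Ioi 1)
    rw [← hmp]
    have hpre : (fun x : ℝ => x + 1) ⁻¹' Ioi 1 = Ioi 0 := by ext; simp
    rw [hpre]
    refine setLIntegral_congr_fun measurableSet_Ioi fun t (ht : 0 < t) => ?_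
    have : {x | t < max (f x - 1) 0} = {x | t + 1 < f x} := by
      ext x
      simp [ht.not_gt, lt_sub_iff_add_lt]
    simp only [this]
  rw [← hshift, ← hlc, mul_comm (ν univ), ← lintegral_const, ← lintegral_add_right _ measurable_const]
  refine lintegral_mono fun x => ?_
  have hsub := intervalIntegral.integral_comp_add_right (a := 0) (b := max (f x - 1) 0)
    (fun t : ℝ => 8 * π * t * exp (4 * π * t ^ 2)) 1
  simp only at hsub ⊢
  rw [hsub, hprim]
  have h1 : (1 : ℝ) ≤ max (f x - 1) 0 + 1 := by linarith [le_max_right (f x - 1) 0]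
  have h2 : f x ≤ max (f x - 1) 0 + 1 := by linarith [le_max_left (f x - 1) 0]
  have h3 : exp (4 * π * f x ^ 2) ≤ exp (4 * π * (max (f x - 1) 0 + 1) ^ 2) := by
    have := hf0 x
    gcongr
  rw [← ENNReal.ofReal_add _ (exp_pos _).le]
  · refine ENNReal.ofReal_le_ofReal ?_
    rw [zero_add, one_pow, mul_one]
    linarith
  · refine sub_nonneg.2 (exp_le_exp.2 ?_)
    gcongr
    linarith

/-- A Trudinger–Moser bound near the centre of the disk. -/
lemma exists_lintegral_exp_sq_ball_le : ∃ C : ℝ, ∀ u : ℂ → ℝ, IsDiskTest u → hardyForm u u ≤ 1 →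
    ∫⁻ z in Metric.ball (0 : ℂ) (1 / 4), ENNReal.ofReal (exp (4 * π * u z ^ 2))
      ≤ ENNReal.ofReal C := by
  obtain ⟨K, hK⟩ := exists_sq_add_le
  obtain ⟨C, hC⟩ := exists_lintegral_mul_le K
  have key : ∀ u : ℂ → ℝ, IsDiskTest u → hardyForm u u ≤ 1 →
      ∫⁻ z in Metric.ball (0 : ℂ) (1 / 4), ENNReal.ofReal (exp (4 * π * max (u z) 0 ^ 2))
        ≤ ENNReal.ofReal (8 * π) * ENNReal.ofReal C
          + volume (Metric.ball (0 : ℂ) (1 / 4)) * ENNReal.ofReal (exp (4 * π)) := by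
    intro u hu hu1
    set D := Metric.ball (0 : ℂ) (1 / 4) with hD
    have hum := hu.continuous.measurable
    set E : ℝ → Set ℂ := fun t => {z | t < max (u z) 0} ∩ D with hE
    have hEm : ∀ t, MeasurableSet (E t) := fun t =>
      (measurableSet_lt measurable_const (hum.max measurable_const)).inter measurableSet_ball
    have hED : ∀ t, E t ⊆ D := fun t => inter_subset_right
    set m : ℝ → ℝ := fun t => volume.real (E t) * exp (4 * π * t ^ 2) with hm
    have hbound := hC m (fun t => by positivity) fun s t hs ht hms hmt => by
      have hvs : volume (E s) ≠ 0 := fun h => by simp [hm, Measure.real, h] at hms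
      have hvt : volume (E t) ≠ 0 := fun h => by simp [hm, Measure.real, h] at hmt
      have hlevel : ∀ r, 1 ≤ r → ∀ x ∈ E r, r ≤ u x := fun r hr x hx => by
        have h : r < max (u x) 0 := hx.1
        rcases lt_max_iff.1 h with h | h
        · exact h.le
        · linarith
      have h := hK u hu hu1 (E s) (E t) (hEm s) (hEm t) (hED s) (hED t) hvs hvt s t
        (by linarith) (by linarith) (hlevel s hs) (hlevel t ht)
      have ls : log (m s) = log (volume.real (E s)) + 4 * π * s ^ 2 := by
        rw [hm, log_mul (volumeReal_pos (hED s) hvs).ne' (exp_pos _).ne', log_exp]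
      have lt : log (m t) = log (volume.real (E t)) + 4 * π * t ^ 2 := by
        rw [hm, log_mul (volumeReal_pos (hED t) hvt).ne' (exp_pos _).ne', log_exp]
      rw [ls, lt]
      linarith
    refine (lintegral_exp_sq_posPart_le (volume.restrict D) (hum.max measurable_const)
      fun z => le_max_right _ _).trans ?_
    rw [Measure.restrict_apply_univ]
    gcongr
    refine le_trans (le_of_eq ?_) (mul_le_mul_right hbound _)
    rw [← lintegral_const_mul' _ _ ENNReal.ofReal_ne_top]
    refine setLIntegral_congr_fun measurableSet_Ioi fun t (ht : 1 < t) => ?_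
    have hmt : (volume.restrict D) {z | t < max (u z) 0} = ENNReal.ofReal (volume.real (E t)) := by
      rw [Measure.restrict_apply' measurableSet_ball, ofReal_measureReal]
    simp only [hmt]
    rw [← ENNReal.ofReal_mul (by positivity), ← ENNReal.ofReal_mul (by positivity)]
    congr 1
    simp only [hm]
    ring
  have hfin : ENNReal.ofReal (8 * π) * ENNReal.ofReal C
      + volume (Metric.ball (0 : ℂ) (1 / 4)) * ENNReal.ofReal (exp (4 * π)) ≠ ∞ := by
    finiteness
  obtain ⟨c, hc⟩ : ∃ c, c = ENNReal.ofReal (8 * π) * ENNReal.ofReal C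
      + volume (Metric.ball (0 : ℂ) (1 / 4)) * ENNReal.ofReal (exp (4 * π)) := ⟨_, rfl⟩
  rw [← hc] at key hfin
  refine ⟨(c + c).toReal, fun u hu hu1 => ?_⟩
  rw [ENNReal.ofReal_toReal (by finiteness)]
  refine le_trans ?_ (add_le_add (key u hu hu1)
    (key (fun z => -u z) hu.neg (IsDiskTest.hardyForm_neg.trans_le hu1)))
  have hum := hu.continuous.measurable
  rw [← lintegral_add_left (by fun_prop)]
  refine lintegral_mono fun z => ?_
  rcases le_total 0 (u z) with h | h
  · rw [max_eq_left h]
    exact le_self_add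
  · rw [max_eq_left (neg_nonneg.2 h), neg_sq]
    exact le_add_self

lemma det_smul_one (c : ℂ) : (c • (1 : ℂ →L[ℝ] ℂ)).det = ‖c‖ ^ 2 := by
  have h : ((c • (1 : ℂ →L[ℝ] ℂ) : ℂ →L[ℝ] ℂ) : ℂ →ₗ[ℝ] ℂ) = Algebra.lmul ℝ ℂ c := by
    ext; all_goals simp
  rw [ContinuousLinearMap.det, h, ← Algebra.norm_apply, Algebra.norm_complex_apply,
    Complex.normSq_eq_norm_sq]

section Mobius

open scoped ComplexConjugate

variable {a z : ℂ}

/-- The Möbius automorphism of the unit disk sending `0` to `a`. -/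
def mobius (a z : ℂ) : ℂ := (z + a) / (1 + conj a * z)

lemma one_add_conj_mul_ne_zero (ha : ‖a‖ < 1) (hz : ‖z‖ < 1) : 1 + conj a * z ≠ 0 := fun h => by
  have h1 : conj a * z = -1 := by linear_combination h
  have h2 : ‖a‖ * ‖z‖ = 1 := by
    simpa using congrArg norm h1
  nlinarith [norm_nonneg a, norm_nonneg z]

lemma one_sub_norm_mobius_sq (ha : ‖a‖ < 1) (hz : ‖z‖ < 1) :
    1 - ‖mobius a z‖ ^ 2 = (1 - ‖a‖ ^ 2) * (1 - ‖z‖ ^ 2) / ‖1 + conj a * z‖ ^ 2 := by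
  have h : ‖1 + conj a * z‖ ^ 2 ≠ 0 := by
    simpa using one_add_conj_mul_ne_zero ha hz
  rw [mobius, norm_div, div_pow, eq_div_iff h, sub_mul, div_mul_cancel₀ _ h]
  simp only [← Complex.normSq_eq_norm_sq, Complex.normSq_apply, Complex.add_re, Complex.add_im,
    Complex.mul_re, Complex.mul_im, Complex.conj_re, Complex.conj_im, Complex.one_re,
    Complex.one_im]
  ring

lemma norm_mobius_lt_one (ha : ‖a‖ < 1) (hz : ‖z‖ < 1) : ‖mobius a z‖ < 1 := by
  have h : 0 < 1 - ‖mobius a z‖ ^ 2 := by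
    rw [one_sub_norm_mobius_sq ha hz]
    have h1 : 0 < 1 - ‖a‖ ^ 2 := one_sub_norm_sq_pos (by simpa using ha)
    have h2 : 0 < 1 - ‖z‖ ^ 2 := one_sub_norm_sq_pos (by simpa using hz)
    have h3 := norm_pos_iff.2 (one_add_conj_mul_ne_zero ha hz)
    positivity
  nlinarith [norm_nonneg (mobius a z)]

lemma mobius_neg_mobius (ha : ‖a‖ < 1) (hz : ‖z‖ < 1) : mobius (-a) (mobius a z) = z := by
  have h := one_add_conj_mul_ne_zero ha hz
  have h' := one_add_conj_mul_ne_zero (a := -a) (by simpa using ha) (norm_mobius_lt_one ha hz)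
  rw [mobius, div_eq_iff h']
  rw [mobius, map_neg]
  rw [mul_comm] at h
  field_simp
  ring

lemma mobius_mobius_neg (ha : ‖a‖ < 1) (hz : ‖z‖ < 1) : mobius a (mobius (-a) z) = z := by
  simpa using mobius_neg_mobius (a := -a) (by simpa using ha) hz

/-- The complex derivative of the Möbius map `mobius a`. -/
def mobiusDeriv (a z : ℂ) : ℂ := (1 - ‖a‖ ^ 2) / (1 + conj a * z) ^ 2

lemma hasDerivAt_mobius (ha : ‖a‖ < 1) (hz : ‖z‖ < 1) :
    HasDerivAt (mobius a) (mobiusDeriv a z) z := by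
  have h := one_add_conj_mul_ne_zero ha hz
  have := ((hasDerivAt_id z).add_const a).div
    (((hasDerivAt_id z).const_mul (conj a)).const_add 1) h
  refine this.congr_deriv ?_
  rw [mobiusDeriv, ← Complex.conj_mul']
  simp only [id]
  ring

lemma norm_mobiusDeriv (ha : ‖a‖ < 1) :
    ‖mobiusDeriv a z‖ = (1 - ‖a‖ ^ 2) / ‖1 + conj a * z‖ ^ 2 := by
  have h1 : 0 < 1 - ‖a‖ ^ 2 := one_sub_norm_sq_pos (by simpa using ha)
  rw [mobiusDeriv, norm_div, norm_pow, ← Complex.ofReal_pow, ← Complex.ofReal_one,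
    ← Complex.ofReal_sub, Complex.norm_of_nonneg h1.le]

lemma hardyWeight_eq (ha : ‖a‖ < 1) (hz : ‖z‖ < 1) :
    hardyWeight z = ‖mobiusDeriv a z‖ ^ 2 * hardyWeight (mobius a z) := by
  have h1 : 0 < 1 - ‖a‖ ^ 2 := one_sub_norm_sq_pos (by simpa using ha)
  have h2 : 0 < 1 - ‖z‖ ^ 2 := one_sub_norm_sq_pos (by simpa using hz)
  have h3 := norm_pos_iff.2 (one_add_conj_mul_ne_zero ha hz)
  rw [hardyWeight, hardyWeight, norm_mobiusDeriv ha, one_sub_norm_mobius_sq ha hz]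
  field_simp

lemma contDiffAt_mobius (ha : ‖a‖ < 1) (hz : ‖z‖ < 1) :
    ContDiffAt ℝ (⊤ : ℕ∞) (mobius a) z := by
  have h : ContDiffAt ℂ (⊤ : ℕ∞) (mobius a) z := (contDiffAt_id.add contDiffAt_const).div
    (contDiffAt_const.add (contDiffAt_const.mul contDiffAt_id)) (one_add_conj_mul_ne_zero ha hz)
  exact h.restrict_scalars ℝ

lemma hasFDerivAt_mobius (ha : ‖a‖ < 1) (hz : ‖z‖ < 1) :
    HasFDerivAt (mobius a) (mobiusDeriv a z • (1 : ℂ →L[ℝ] ℂ)) z :=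
  (hasDerivAt_mobius ha hz).complexToReal_fderiv

lemma injOn_mobius (ha : ‖a‖ < 1) : InjOn (mobius a) (Metric.ball 0 1) := fun z hz w hw h => by
  rw [← mobius_neg_mobius (z := z) ha (by simpa using hz), h, mobius_neg_mobius ha (by simpa using hw)]

lemma image_mobius_ball (ha : ‖a‖ < 1) :
    mobius a '' Metric.ball 0 1 = Metric.ball 0 1 := by
  ext w
  refine ⟨?_, fun hw => ⟨mobius (-a) w, ?_, mobius_mobius_neg ha (by simpa using hw)⟩⟩
  · rintro ⟨z, hz, rfl⟩
    simpa using norm_mobius_lt_one ha (by simpa using hz)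
  · simpa using norm_mobius_lt_one (a := -a) (by simpa using ha) (by simpa using hw)

/-- Precomposition of a function on the disk with a Möbius automorphism. -/
def pullback (a : ℂ) (u : ℂ → ℝ) : ℂ → ℝ :=
  (Metric.ball (0 : ℂ) 1).indicator fun z => u (mobius a z)

lemma pullback_apply (u : ℂ → ℝ) (hz : ‖z‖ < 1) : pullback a u z = u (mobius a z) :=
  indicator_of_mem (by simpa using hz) _

lemma pullback_eventuallyEq (u : ℂ → ℝ) (hz : ‖z‖ < 1) :
    pullback a u =ᶠ[nhds z] fun z => u (mobius a z) := by
  filter_upwards [Metric.isOpen_ball.mem_nhds (by simpa using hz : z ∈ Metric.ball (0 : ℂ) 1)]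
    with w hw
  exact pullback_apply u (by simpa using hw)

lemma IsDiskTest.pullback {u : ℂ → ℝ} (hu : IsDiskTest u) (ha : ‖a‖ < 1) :
    IsDiskTest (pullback a u) := by
  have hna : ‖-a‖ < 1 := by simpa using ha
  have hK : IsCompact (mobius (-a) '' tsupport u) := hu.2.1.image_of_continuousOn fun z hz =>
    (contDiffAt_mobius hna (by simpa using hu.2.2 hz)).continuousAt.continuousWithinAt
  have hsupp : tsupport (HardyMoser.pullback a u) ⊆ mobius (-a) '' tsupport u := by
    refine closure_minimal (fun z hz => ?_) hK.isClosed
    have hzb : ‖z‖ < 1 := by simpa using mem_of_indicator_ne_zero hz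
    refine ⟨mobius a z, subset_tsupport _ ?_, mobius_neg_mobius ha hzb⟩
    rwa [Function.mem_support, pullback_apply u hzb] at hz
  have hsub : tsupport (HardyMoser.pullback a u) ⊆ Metric.ball 0 1 :=
    hsupp.trans ((image_mono hu.2.2).trans (image_mobius_ball hna).subset)
  refine ⟨contDiff_iff_contDiffAt.2 fun z => ?_, HasCompactSupport.of_support_subset_isCompact hK
    ((subset_tsupport _).trans hsupp), hsub⟩
  by_cases hz : z ∈ tsupport (HardyMoser.pullback a u)
  · have hzb : ‖z‖ < 1 := by simpa using hsub hz
    exact (hu.1.contDiffAt.comp z (contDiffAt_mobius ha hzb)).congr_of_eventuallyEq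
      (pullback_eventuallyEq u hzb)
  · exact contDiffAt_const.congr_of_eventuallyEq (notMem_tsupport_iff_eventuallyEq.1 hz)

lemma apply_eq_re_add_im (L : ℂ →L[ℝ] ℝ) (w : ℂ) : L w = w.re * L 1 + w.im * L Complex.I := by
  have e : w = w.re • (1 : ℂ) + w.im • Complex.I := by
    simp
  conv_lhs => rw [e, map_add, map_smul, map_smul, smul_eq_mul, smul_eq_mul]

lemma sq_add_sq_apply_mul (L : ℂ →L[ℝ] ℝ) (c : ℂ) :
    L (c * 1) * L (c * 1) + L (c * Complex.I) * L (c * Complex.I)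
      = ‖c‖ ^ 2 * (L 1 * L 1 + L Complex.I * L Complex.I) := by
  rw [apply_eq_re_add_im L (c * 1), apply_eq_re_add_im L (c * Complex.I),
    ← Complex.normSq_eq_norm_sq, Complex.normSq_apply]
  simp
  ring

lemma IsDiskTest.hardyForm_eq_setIntegral {u : ℂ → ℝ} (hu : IsDiskTest u) :
    hardyForm u u = ∫ z in Metric.ball 0 1, (fderiv ℝ u z 1 * fderiv ℝ u z 1
      + fderiv ℝ u z Complex.I * fderiv ℝ u z Complex.I - hardyWeight z * (u z * u z)) :=
  (setIntegral_eq_integral_of_forall_compl_eq_zero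
    fun _ hz => (hu.hardyForm_integrand hu).eq_zero hz).symm

lemma IsDiskTest.hardyForm_pullback {u : ℂ → ℝ} (hu : IsDiskTest u) (ha : ‖a‖ < 1) :
    hardyForm (HardyMoser.pullback a u) (HardyMoser.pullback a u) = hardyForm u u := by
  rw [(hu.pullback ha).hardyForm_eq_setIntegral, hu.hardyForm_eq_setIntegral]
  conv_rhs => rw [← image_mobius_ball ha]
  rw [integral_image_eq_integral_abs_det_fderiv_smul volume measurableSet_ball
    (fun z hz => (hasFDerivAt_mobius ha (by simpa using hz)).hasFDerivWithinAt) (injOn_mobius ha)]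
  refine setIntegral_congr_fun measurableSet_ball fun z hz => ?_
  have hz1 : ‖z‖ < 1 := by simpa using hz
  have hd : ∀ w, fderiv ℝ (HardyMoser.pullback a u) z w
      = fderiv ℝ u (mobius a z) (mobiusDeriv a z * w) := fun w => by
    rw [(pullback_eventuallyEq u hz1).fderiv_eq]
    have := (hu.differentiable (mobius a z)).hasFDerivAt.comp z (hasFDerivAt_mobius ha hz1)
    exact (DFunLike.congr_fun this.fderiv w).trans (by simp)
  simp only [hd, det_smul_one, pullback_apply u hz1, sq_add_sq_apply_mul, smul_eq_mul]
  rw [hardyWeight_eq ha hz1, abs_of_nonneg (sq_nonneg _)]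
  ring

end Mobius

section NearDiagonal

open scoped ComplexConjugate

variable {a x : ℂ}

lemma norm_lt_one_of_dist_lt (h : ‖a - x‖ < (1 - ‖x‖) / 4) : ‖x‖ < 1 ∧ ‖a‖ < 1 := by
  have h1 := norm_nonneg (a - x)
  have h2 := norm_sub_norm_le a x
  constructor <;> linarith

lemma norm_mobius_neg_lt (h : ‖a - x‖ < (1 - ‖x‖) / 4) : ‖mobius (-a) x‖ < 1 / 4 := by
  obtain ⟨hx, ha⟩ := norm_lt_one_of_dist_lt h
  have hne := norm_pos_iff.2 (one_add_conj_mul_ne_zero (a := -a) (by simpa using ha) hx)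
  have hlow : 1 - ‖x‖ ≤ ‖1 + conj (-a) * x‖ := by
    have h1 := norm_sub_norm_le (1 : ℂ) (-(conj (-a) * x))
    rw [norm_one, norm_neg, norm_mul, RCLike.norm_conj, norm_neg, sub_neg_eq_add] at h1
    nlinarith [norm_nonneg x]
  rw [mobius, norm_div, div_lt_iff₀ hne, ← sub_eq_add_neg, norm_sub_rev]
  linarith

lemma le_norm_mobiusDeriv_neg (h : ‖a - x‖ < (1 - ‖x‖) / 4) :
    1 / 10 / (1 - ‖x‖) ≤ ‖mobiusDeriv (-a) x‖ := by
  obtain ⟨hx, ha⟩ := norm_lt_one_of_dist_lt h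
  have hne := norm_pos_iff.2 (one_add_conj_mul_ne_zero (a := -a) (by simpa using ha) hx)
  have hup : ‖1 + conj (-a) * x‖ ≤ 9 / 4 * (1 - ‖x‖) := by
    have e : 1 + conj (-a) * x = ((1 - ‖x‖ ^ 2 : ℝ) : ℂ) - conj (a - x) * x := by
      push_cast
      rw [← Complex.conj_mul', map_sub, map_neg]
      ring
    rw [e]
    refine (norm_sub_le _ _).trans ?_
    rw [norm_mul, RCLike.norm_conj, Complex.norm_of_nonneg (by nlinarith [norm_nonneg x])]
    nlinarith [norm_nonneg x, norm_nonneg (a - x)]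
  have hna : 3 / 4 * (1 - ‖x‖) ≤ 1 - ‖a‖ ^ 2 := by
    have h2 := norm_sub_norm_le a x
    nlinarith [norm_nonneg a]
  have hx' : 0 < 1 - ‖x‖ := by linarith
  rw [norm_mobiusDeriv (by simpa using ha), norm_neg, div_div,
    div_le_div_iff₀ (by positivity) (by positivity)]
  calc 1 * ‖1 + conj (-a) * x‖ ^ 2 ≤ 1 * (9 / 4 * (1 - ‖x‖)) ^ 2 := by gcongr
    _ ≤ 3 / 4 * (1 - ‖x‖) * (10 * (1 - ‖x‖)) := by nlinarith
    _ ≤ _ := by gcongr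

lemma lintegral_near_le (ha : ‖a‖ < 1) (Φ : ℂ → ℝ≥0∞) :
    ∫⁻ x in {x | ‖a - x‖ < (1 - ‖x‖) / 4}, ENNReal.ofReal ((1 / 10 / (1 - ‖x‖)) ^ 2) * Φ x
      ≤ ∫⁻ z in Metric.ball 0 (1 / 4), Φ (mobius a z) := by
  have hm : MeasurableSet {x | ‖a - x‖ < (1 - ‖x‖) / 4} :=
    (isOpen_lt (by fun_prop) (by fun_prop)).measurableSet
  have hna : ‖-a‖ < 1 := by simpa using ha
  have hsub : {x | ‖a - x‖ < (1 - ‖x‖) / 4} ⊆ Metric.ball 0 1 := fun x hx => by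
    simpa using (norm_lt_one_of_dist_lt hx).1
  have himg : mobius (-a) '' {x | ‖a - x‖ < (1 - ‖x‖) / 4} ⊆ Metric.ball 0 (1 / 4) := by
    rintro _ ⟨x, hx, rfl⟩
    simpa using norm_mobius_neg_lt hx
  refine le_trans ?_ (lintegral_mono_set himg)
  rw [lintegral_image_eq_lintegral_abs_det_fderiv_mul volume hm
    (fun x hx => (hasFDerivAt_mobius hna (by simpa using hsub hx)).hasFDerivWithinAt)
    ((injOn_mobius hna).mono hsub)]
  refine setLIntegral_mono' hm fun x hx => ?_
  have hx1 : ‖x‖ < 1 := by simpa using hsub hx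
  have hx' : 0 < 1 - ‖x‖ := by linarith
  rw [mobius_mobius_neg ha hx1, det_smul_one, abs_of_nonneg (sq_nonneg _)]
  gcongr
  exact le_norm_mobiusDeriv_neg hx

end NearDiagonal

/-- Averaging over Möbius automorphisms turns a bound near the centre into a global bound. -/
lemma lintegral_ball_le_of_forall_mobius {Φ : ℂ → ℝ≥0∞} (hΦ : Measurable Φ) {C : ℝ≥0∞}
    (h : ∀ a : ℂ, ‖a‖ < 1 → ∫⁻ z in Metric.ball 0 (1 / 4), Φ (mobius a z) ≤ C) :
    ENNReal.ofReal (π / 1600) * ∫⁻ x in Metric.ball 0 1, Φ x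
      ≤ C * volume (Metric.ball (0 : ℂ) 1) := by
  set N : Set (ℂ × ℂ) := {p | ‖p.1 - p.2‖ < (1 - ‖p.2‖) / 4} with hN
  have hNm : MeasurableSet N := (isOpen_lt (by fun_prop) (by fun_prop)).measurableSet
  set J : ℂ → ℂ → ℝ≥0∞ := fun a x =>
    N.indicator (fun p => ENNReal.ofReal ((1 / 10 / (1 - ‖p.2‖)) ^ 2) * Φ p.2) (a, x) with hJ
  have hJm : Measurable (Function.uncurry J) := by
    have : Measurable fun p : ℂ × ℂ => ENNReal.ofReal ((1 / 10 / (1 - ‖p.2‖)) ^ 2) * Φ p.2 := by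
      fun_prop
    exact this.indicator hNm
  have hupper : ∀ a, ∫⁻ x, J a x ≤ (Metric.ball (0 : ℂ) 1).indicator (fun _ => C) a := fun a => by
    have e : ∫⁻ x, J a x = ∫⁻ x in {x | ‖a - x‖ < (1 - ‖x‖) / 4},
        ENNReal.ofReal ((1 / 10 / (1 - ‖x‖)) ^ 2) * Φ x := by
      rw [← lintegral_indicator (isOpen_lt (by fun_prop) (by fun_prop)).measurableSet]
      rfl
    rw [e]
    by_cases ha : ‖a‖ < 1
    · rw [indicator_of_mem (by simpa using ha)]
      exact (lintegral_near_le ha Φ).trans (h a ha)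
    · have : {x | ‖a - x‖ < (1 - ‖x‖) / 4} = ∅ :=
        eq_empty_of_forall_notMem fun x hx => ha (norm_lt_one_of_dist_lt hx).2
      simp [this]
  have hlower : ∀ x ∈ Metric.ball (0 : ℂ) 1,
      ENNReal.ofReal (π / 1600) * Φ x = ∫⁻ a, J a x := fun x hx => by
    have hx' : 0 < 1 - ‖x‖ := by simpa using hx
    have e : ∀ a, J a x = (Metric.ball x ((1 - ‖x‖) / 4)).indicator
        (fun _ => ENNReal.ofReal ((1 / 10 / (1 - ‖x‖)) ^ 2) * Φ x) a := fun a => by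
      simp only [hJ, hN, indicator, mem_ofPred_eq, mem_ball_iff_norm]
    simp only [e]
    rw [lintegral_indicator_const measurableSet_ball, Complex.volume_ball,
      ← ENNReal.ofReal_coe_nnreal, NNReal.coe_real_pi, ← ENNReal.ofReal_pow (by positivity),
      ← ENNReal.ofReal_mul (by positivity), mul_right_comm, ← ENNReal.ofReal_mul (by positivity)]
    congr 2
    field_simp
    norm_num
  calc ENNReal.ofReal (π / 1600) * ∫⁻ x in Metric.ball 0 1, Φ x
      = ∫⁻ x in Metric.ball 0 1, ENNReal.ofReal (π / 1600) * Φ x :=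
        (lintegral_const_mul _ hΦ).symm
    _ = ∫⁻ x in Metric.ball 0 1, ∫⁻ a, J a x := setLIntegral_congr_fun measurableSet_ball hlower
    _ ≤ ∫⁻ x, ∫⁻ a, J a x := setLIntegral_le_lintegral _ _
    _ = ∫⁻ a, ∫⁻ x, J a x := (lintegral_lintegral_swap hJm.aemeasurable).symm
    _ ≤ ∫⁻ a, (Metric.ball (0 : ℂ) 1).indicator (fun _ => C) a := lintegral_mono hupper
    _ = _ := lintegral_indicator_const measurableSet_ball _

/-- The Trudinger–Moser inequality of Wang and Ye, on the unit disk of `ℂ`. -/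
lemma exists_lintegral_exp_sq_le : ∃ C : ℝ, 0 ≤ C ∧ ∀ u : ℂ → ℝ, IsDiskTest u →
    hardyForm u u ≤ 1 →
    ∫⁻ z in Metric.ball (0 : ℂ) 1, ENNReal.ofReal (exp (4 * π * u z ^ 2)) ≤ ENNReal.ofReal C := by
  obtain ⟨C, hC⟩ := exists_lintegral_exp_sq_ball_le
  set M : ℝ≥0∞ := ENNReal.ofReal C * volume (Metric.ball (0 : ℂ) 1) / ENNReal.ofReal (π / 1600)
    with hM
  have hpos : ENNReal.ofReal (π / 1600) ≠ 0 := by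
    have := pi_pos
    simpa using this
  have hMfin : M ≠ ∞ := ENNReal.div_ne_top (by finiteness) hpos
  refine ⟨M.toReal, ENNReal.toReal_nonneg, fun u hu hu1 => ?_⟩
  have hum := hu.continuous.measurable
  rw [ENNReal.ofReal_toReal hMfin, hM,
    ENNReal.le_div_iff_mul_le (Or.inl hpos) (Or.inl ENNReal.ofReal_ne_top), mul_comm]
  refine lintegral_ball_le_of_forall_mobius (by fun_prop) fun a ha => ?_
  refine le_trans (le_of_eq ?_) (hC _ (hu.pullback ha) ((hu.hardyForm_pullback ha).trans_le hu1))
  refine setLIntegral_congr_fun measurableSet_ball fun z hz => ?_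
  have hz1 : ‖z‖ < 1 := by
    have : ‖z‖ < 1 / 4 := by simpa using hz
    linarith
  simp only [pullback_apply u hz1]

lemma norm_sq_eq_sq_add_sq (L : ℂ →L[ℝ] ℝ) :
    ‖L‖ ^ 2 = L 1 * L 1 + L Complex.I * L Complex.I := by
  have h : L = innerSL ℝ (⟨L 1, L Complex.I⟩ : ℂ) := by
    ext w
    rw [apply_eq_re_add_im L w]
    simp [innerSL_apply_apply, Complex.inner]
  conv_lhs => rw [h, innerSL_apply_norm]
  rw [← Complex.normSq_eq_norm_sq, Complex.normSq_apply]

/-- The standard isometry between `ℂ` and the Euclidean plane. -/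
def planeEquiv : ℂ ≃ₗᵢ[ℝ] E2 := Complex.orthonormalBasisOneI.repr

lemma setIntegral_unitDisk (f : E2 → ℝ) :
    ∫ x in unitDisk, f x = ∫ z in Metric.ball (0 : ℂ) 1, f (planeEquiv z) := by
  have hpre : planeEquiv ⁻¹' unitDisk = Metric.ball 0 1 := by
    ext z
    simp [unitDisk]
  rw [← hpre]
  exact (planeEquiv.measurePreserving.setIntegral_preimage_emb
    planeEquiv.toHomeomorph.measurableEmbedding f unitDisk).symm

lemma isDiskTest_comp {u : E2 → ℝ} (hu : IsTestFun unitDisk u) :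
    IsDiskTest fun z => u (planeEquiv z) := by
  have hts : tsupport (fun z => u (planeEquiv z)) = planeEquiv ⁻¹' tsupport u :=
    tsupport_comp_eq_preimage u planeEquiv.toHomeomorph
  refine ⟨hu.1.comp planeEquiv.contDiff, ?_, ?_⟩
  · exact HasCompactSupport.comp_homeomorph hu.2.1 planeEquiv.toHomeomorph
  · rw [hts]
    intro z hz
    simpa [unitDisk] using hu.2.2 hz

lemma norm_fderiv_comp {u : E2 → ℝ} (hu : IsTestFun unitDisk u) (z : ℂ) :
    ‖fderiv ℝ u (planeEquiv z)‖ = ‖fderiv ℝ (fun z => u (planeEquiv z)) z‖ := by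
  have h : fderiv ℝ (fun z => u (planeEquiv z)) z
      = (fderiv ℝ u (planeEquiv z)).comp (planeEquiv : ℂ →L[ℝ] E2) :=
    ((hu.1.differentiable (by simp) _).hasFDerivAt.comp z
      (planeEquiv : ℂ ≃L[ℝ] E2).hasFDerivAt).fderiv
  rw [h]
  exact (ContinuousLinearMap.opNorm_comp_linearIsometryEquiv _ planeEquiv).symm

lemma hardyForm_comp {u : E2 → ℝ} (hu : IsTestFun unitDisk u) :
    hardyForm (fun z => u (planeEquiv z)) (fun z => u (planeEquiv z))
      = (∫ x in unitDisk, ‖fderiv ℝ u x‖ ^ 2)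
        - ∫ x in unitDisk, u x ^ 2 / (1 - ‖x‖ ^ 2) ^ 2 := by
  have hv := isDiskTest_comp hu
  set v : ℂ → ℝ := fun z => u (planeEquiv z) with hvdef
  rw [hv.hardyForm_eq_setIntegral, setIntegral_unitDisk, setIntegral_unitDisk,
    integral_sub (((hv.fderiv_apply 1).mul (hv.fderiv_apply 1)).add
      ((hv.fderiv_apply _).mul (hv.fderiv_apply _))).integrable.integrableOn
      (hv.mul hv).weight_mul.integrable.integrableOn]
  congr 1
  · simp only [norm_fderiv_comp hu, norm_sq_eq_sq_add_sq, hvdef]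
  · congr 1
    ext z
    rw [LinearIsometryEquiv.norm_map, hardyWeight, div_eq_mul_inv, hvdef]
    ring

end HardyMoser

/-- Wang–Ye: the Trudinger-Moser supremum under the constraint
`∫_B |∇u|² - ∫_B u²/(1-|x|²)² ≤ 1` is finite. -/
theorem trudinger_moser_wang_ye :
    ∃ C : ℝ, ∀ u : E2 → ℝ, IsTestFun unitDisk u →
      (∫ x in unitDisk, ‖fderiv ℝ u x‖ ^ 2) -
        (∫ x in unitDisk, u x ^ 2 / (1 - ‖x‖ ^ 2) ^ 2) ≤ 1 →
      (∫ x in unitDisk, Real.exp (4 * π * u x ^ 2)) ≤ C := by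
  obtain ⟨C, hC0, hC⟩ := HardyMoser.exists_lintegral_exp_sq_le
  refine ⟨C, fun u hu hu1 => ?_⟩
  have hv := HardyMoser.isDiskTest_comp hu
  have hc : Continuous fun z => exp (4 * π * u (HardyMoser.planeEquiv z) ^ 2) :=
    continuous_exp.comp (continuous_const.mul (hv.continuous.pow 2))
  rw [HardyMoser.setIntegral_unitDisk,
    integral_eq_lintegral_of_nonneg_ae (ae_of_all _ fun z => (exp_pos _).le)
      hc.aestronglyMeasurable]
  exact ENNReal.toReal_le_of_le_ofReal hC0
    (hC _ hv ((HardyMoser.hardyForm_comp hu).trans_le hu1))
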